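/- Let C be a mild contour in a ray category P which is a penny-farthing with points x_0, …, x_{n-1}, arrows α_1, …, α_n and loop ρ at x_0. If P(x_0, y) ≠ {0} for some object y of P not belonging to C, then n = 2. -/

import Mathlib

set_option autoImplicit false

/-- A ray category (Bautista–Gabriel–Roiter–Salmerón).  The fields `pipow x`
record the powers of the generator `π(x)` of the radical of `P(x,x)`. -/
structure RayCategory : Type 1 where
  Obj : Type
  Hom : Obj → Obj → Type
  id : ∀ x : Obj, Hom x x
  comp : ∀ {x y z : Obj}, Hom y z → Hom x y → Hom x z
  zero : ∀ x y : Obj, Hom x y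
  comp_id : ∀ {x y : Obj} (f : Hom x y), comp f (id x) = f
  id_comp : ∀ {x y : Obj} (f : Hom x y), comp (id y) f = f
  assoc : ∀ {x y z w : Obj} (h : Hom z w) (g : Hom y z) (f : Hom x y),
      comp (comp h g) f = comp h (comp g f)
  /-- axiom b : zero morphisms -/
  zero_comp : ∀ {x y z : Obj} (f : Hom x y), comp (zero y z) f = zero x z
  comp_zero : ∀ {x y z : Obj} (f : Hom y z), comp f (zero x y) = zero x z
  /-- axiom a : the objects are pairwise non-isomorphic -/
  no_iso : ∀ {x y : Obj} (f : Hom x y) (g : Hom y x),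
      comp g f = id x → comp f g = id y → x = y
  /-- axiom c : local finiteness -/
  finite_target : ∀ x : Obj, {y : Obj | ∃ f : Hom x y, f ≠ zero x y}.Finite
  finite_source : ∀ x : Obj, {y : Obj | ∃ f : Hom y x, f ≠ zero y x}.Finite
  /-- the powers of the generator `π(x)` of `P(x,x)`; `pipow x 1 = π(x)`. -/
  pipow : ∀ x : Obj, ℕ → Hom x x
  pipow_zero : ∀ x, pipow x 0 = id x
  pipow_succ : ∀ x n, pipow x (n + 1) = comp (pipow x 1) (pipow x n)
  nilp : Obj → ℕ
  nilp_pos : ∀ x, 1 ≤ nilp x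
  /-- axiom d : `P(x,x) = {id, σ, …, σ^{n-1} ≠ 0 = σ^n}` -/
  endo_cyclic : ∀ (x : Obj) (f : Hom x x), ∃ i : ℕ, f = pipow x i
  pipow_nilp : ∀ x, pipow x (nilp x) = zero x x
  pipow_nilp_ne : ∀ x, pipow x (nilp x - 1) ≠ zero x x
  /-- axiom e : `P(x,y)` is cyclic under the action of `P(x,x)` or of `P(y,y)` -/
  hom_cyclic : ∀ x y : Obj, ∃ g : Hom x y,
      (∀ f : Hom x y, ∃ i : ℕ, f = comp (pipow y i) g) ∨
      (∀ f : Hom x y, ∃ i : ℕ, f = comp g (pipow x i))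
  /-- axiom f : cancellation -/
  cancel : ∀ {x y z w : Obj} (kappa : Hom x y) (mu nu : Hom y z) (lam : Hom z w),
      comp lam (comp mu kappa) = comp lam (comp nu kappa) →
      comp lam (comp mu kappa) ≠ zero x w → mu = nu

namespace RayCategory

variable (P : RayCategory)

/-- the generator of the radical of `P(x,x)` -/
def pi (x : P.Obj) : P.Hom x x := P.pipow x 1

/-- powers of an endomorphism -/
def pow {x : P.Obj} (f : P.Hom x x) : ℕ → P.Hom x x
  | 0 => P.id x
  | n + 1 => P.comp f (pow f n)

/-- `f` is an identity morphism -/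
def IsId {x y : P.Obj} (f : P.Hom x y) : Prop := ∃ _ : x = y, HEq f (P.id x)

/-- irreducible morphisms (= arrows of the quiver of `P`): nonzero morphisms which are
not identities and cannot be written as a product of two non-identity morphisms -/
def IsIrreducible {x y : P.Obj} (f : P.Hom x y) : Prop :=
  f ≠ P.zero x y ∧ ¬ P.IsId f ∧
    ∀ (z : P.Obj) (g : P.Hom z y) (h : P.Hom x z), f = P.comp g h → P.IsId g ∨ P.IsId h

/-- irreducibility inside the full subcategory supported by `S` -/
def IsIrreducibleOn (S : Set P.Obj) {x y : P.Obj} (f : P.Hom x y) : Prop :=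
  f ≠ P.zero x y ∧ ¬ P.IsId f ∧
    ∀ z ∈ S, ∀ (g : P.Hom z y) (h : P.Hom x z), f = P.comp g h → P.IsId g ∨ P.IsId h

/-- the sub-bimodule `P(y,y) μ P(x,x)` of `P(x,y)` generated by `μ` -/
def Bimod {x y : P.Obj} (mu : P.Hom x y) : Set (P.Hom x y) :=
  {f | ∃ i j : ℕ, f = P.comp (P.pipow y i) (P.comp mu (P.pipow x j))}

/-- `μ` is transit : the sub-bimodule generated by `μ` is cyclic over `P(y,y)` -/
def IsTransit {x y : P.Obj} (mu : P.Hom x y) : Prop :=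
  mu ≠ P.zero x y ∧
    ∃ g ∈ P.Bimod mu, ∀ f ∈ P.Bimod mu, ∃ i : ℕ, f = P.comp (P.pipow y i) g

/-- `μ` is cotransit : the sub-bimodule generated by `μ` is cyclic over `P(x,x)` -/
def IsCotransit {x y : P.Obj} (mu : P.Hom x y) : Prop :=
  mu ≠ P.zero x y ∧
    ∃ g ∈ P.Bimod mu, ∀ f ∈ P.Bimod mu, ∃ j : ℕ, f = P.comp g (P.pipow x j)

/-- `μ` is deep : `π(y)μ = 0 = μπ(x)` -/
def IsDeep {x y : P.Obj} (mu : P.Hom x y) : Prop :=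
  mu ≠ P.zero x y ∧ P.comp (P.pi y) mu = P.zero x y ∧ P.comp mu (P.pi x) = P.zero x y

/-- transport of a morphism along equalities of objects -/
def castHom {a b c d : P.Obj} (h1 : a = c) (h2 : b = d) (f : P.Hom a b) : P.Hom c d :=
  cast (by rw [h1, h2]) f

/-- the composite `a_{i+j-1} ⋯ a_{i+1} a_i : x_i → x_{i+j}` of a chain of morphisms -/
def chain (x : ℕ → P.Obj) (a : ∀ i : ℕ, P.Hom (x i) (x (i + 1))) (i : ℕ) :
    ∀ j : ℕ, P.Hom (x i) (x (i + j))
  | 0 => P.id (x i)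
  | j + 1 => P.comp (a (i + j)) (chain x a i j)

end RayCategory

/-- Paths in the quiver `Q_P` of a ray category `P` (the arrow `f` of `cons f hf p`
is the *last* arrow of the path). -/
inductive RPath (P : RayCategory) : P.Obj → P.Obj → Type
  | nil (x : P.Obj) : RPath P x x
  | cons {x y z : P.Obj} (f : P.Hom y z) (hf : P.IsIrreducible f) (p : RPath P x y) :
      RPath P x z

namespace RPath

variable {P : RayCategory}

/-- the morphism `v⃗` of `P` obtained by composing the arrows of a path `v` -/
def toHom : ∀ {x y : P.Obj}, RPath P x y → P.Hom x y
  | _, _, .nil x => P.id x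
  | _, _, .cons f _ p => P.comp f p.toHom

def length : ∀ {x y : P.Obj}, RPath P x y → ℕ
  | _, _, .nil _ => 0
  | _, _, .cons _ _ p => p.length + 1

/-- the set of points visited by a path -/
def points : ∀ {x y : P.Obj}, RPath P x y → Set P.Obj
  | _, _, .nil x => {x}
  | _, _, @RPath.cons _ _ _ z _ _ p => insert z p.points

/-- concatenation of paths -/
def append : ∀ {x y z : P.Obj}, RPath P y z → RPath P x y → RPath P x z
  | _, _, _, .nil _, p => p
  | _, _, _, .cons f hf q, p => .cons f hf (q.append p)

/-- the arrow `g` occurs in the path -/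
def HasArrow : ∀ {x y : P.Obj}, RPath P x y → ∀ {a b : P.Obj}, P.Hom a b → Prop
  | _, _, .nil _, _, _, _ => False
  | _, _, .cons f _ p, _, _, g => HEq f g ∨ p.HasArrow g

/-- one step of the interlacing relation: `v = p v' q`, `w = p w' q` with
`v⃗' = w⃗' ≠ 0` and `p`, `q` not both identities -/
def InterlaceStep {x y : P.Obj} (v w : RPath P x y) : Prop :=
  ∃ (a b : P.Obj) (p : RPath P b y) (v' w' : RPath P a b) (q : RPath P x a),
    v = p.append (v'.append q) ∧ w = p.append (w'.append q) ∧
    v'.toHom = w'.toHom ∧ v'.toHom ≠ P.zero a b ∧ ¬ (p.length = 0 ∧ q.length = 0)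

/-- two paths are interlaced if they lie in the transitive closure of the relation above -/
def Interlaced {x y : P.Obj} (v w : RPath P x y) : Prop :=
  Relation.TransGen (fun v' w' : RPath P x y => InterlaceStep v' w') v w

end RPath

/-- a chain of arrows as a path -/
def pchain (P : RayCategory) (x : ℕ → P.Obj) (a : ∀ i : ℕ, P.Hom (x i) (x (i + 1)))
    (ha : ∀ i, P.IsIrreducible (a i)) (i : ℕ) : ∀ j : ℕ, RPath P (x i) (x (i + j))
  | 0 => .nil (x i)
  | j + 1 => .cons (a (i + j)) (ha (i + j)) (pchain P x a ha i j)

/-- A contour `C = {v,w}` of `P` from `x` to `y` : a pair of different, non-interlaced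
paths with `v⃗ = w⃗ ≠ 0`. -/
structure Contour (P : RayCategory) (x y : P.Obj) : Type where
  v : RPath P x y
  w : RPath P x y
  ne : v ≠ w
  hom_eq : v.toHom = w.toHom
  nz : v.toHom ≠ P.zero x y
  nint : ¬ RPath.Interlaced v w
/-- A module over the linearization `k(D/I)` of the quotient by the ideal generated by the
morphisms in `I` of the full subcategory of `P` supported by `D`:
a `k`-linear functor defined on the morphisms between points of `D`, vanishing on `I`.
For `D = Set.univ` and `I = fun _ _ _ => False` this is exactly a `k(P)`-module. -/
structure RMod (P : RayCategory) (k : Type) [Field k] (D : Set P.Obj)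
    (I : ∀ a b : P.Obj, P.Hom a b → Prop) where
  M : P.Obj → Type
  [acg : ∀ x, AddCommGroup (M x)]
  [mod : ∀ x, Module k (M x)]
  act : ∀ {x y : P.Obj}, P.Hom x y → (M x →ₗ[k] M y)
  act_id : ∀ x ∈ D, act (P.id x) = LinearMap.id
  act_comp : ∀ {x y z : P.Obj}, x ∈ D → y ∈ D → z ∈ D →
      ∀ (g : P.Hom y z) (f : P.Hom x y), act (P.comp g f) = (act g).comp (act f)
  act_zero : ∀ {x y : P.Obj}, x ∈ D → y ∈ D → act (P.zero x y) = 0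
  supp : ∀ x : P.Obj, x ∉ D → ∀ m : M x, m = 0
  killed : ∀ {a b : P.Obj} (f : P.Hom a b), I a b f → act f = 0

attribute [instance] RMod.acg RMod.mod

/-- morphisms of modules -/
structure RModHom {P : RayCategory} {k : Type} [Field k] {D : Set P.Obj}
    {I : ∀ a b : P.Obj, P.Hom a b → Prop} (M N : RMod P k D I) where
  app : ∀ x : P.Obj, M.M x →ₗ[k] N.M x
  natural : ∀ {x y : P.Obj} (f : P.Hom x y), (N.act f).comp (app x) = (app y).comp (M.act f)

/-- isomorphism of modules -/
def RModIso {P : RayCategory} {k : Type} [Field k] {D : Set P.Obj}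
    {I : ∀ a b : P.Obj, P.Hom a b → Prop} (M N : RMod P k D I) : Prop :=
  ∃ φ : RModHom M N, ∀ x, Function.Bijective (φ.app x)

namespace RMod

variable {P : RayCategory} {k : Type} [Field k] {D : Set P.Obj}
  {I : ∀ a b : P.Obj, P.Hom a b → Prop}

/-- finite-dimensional: the sum of the dimensions of all `M x` is finite -/
def FinDim (M : RMod P k D I) : Prop :=
  (∀ x, FiniteDimensional k (M.M x)) ∧ {x : P.Obj | ∃ m : M.M x, m ≠ 0}.Finite

def Nonzero (M : RMod P k D I) : Prop := ∃ x, ∃ m : M.M x, m ≠ 0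

/-- indecomposable: nonzero, and the only idempotent endomorphisms are `0` and `id` -/
def Indec (M : RMod P k D I) : Prop :=
  M.Nonzero ∧ ∀ e : RModHom M M, (∀ x, (e.app x).comp (e.app x) = e.app x) →
    (∀ x, e.app x = 0) ∨ (∀ x, e.app x = LinearMap.id)

end RMod

/-- the full subcategory supported by `D` of the quotient of `P` by the ideal generated
by `I` is (locally) representation-finite: for any field `k`, every point lies in the
support of only finitely many isomorphism classes of finite-dimensional indecomposables -/
def RepFin (P : RayCategory) (D : Set P.Obj) (I : ∀ a b : P.Obj, P.Hom a b → Prop) : Prop :=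
  ∀ (k : Type) [Field k], ∀ x : P.Obj,
    ∃ (ι : Type) (_ : Finite ι) (rep : ι → RMod P k D I),
      ∀ M : RMod P k D I, M.FinDim → M.Indec → (∃ m : M.M x, m ≠ 0) →
        ∃ i : ι, RModIso (rep i) M

/-- the trivial ideal -/
def RayCategory.noIdeal (P : RayCategory) : ∀ a b : P.Obj, P.Hom a b → Prop :=
  fun _ _ _ => False

/-- `P` is locally representation-finite -/
def LocRepFin (P : RayCategory) : Prop := RepFin P Set.univ P.noIdeal

/-- the ideal of `P` generated by the morphism `μ` -/
def IdealOf (P : RayCategory) {a b : P.Obj} (mu : P.Hom a b) :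
    ∀ s t : P.Obj, P.Hom s t → Prop :=
  fun s t f => ∃ (g : P.Hom b t) (h : P.Hom s a), f = P.comp g (P.comp mu h)

/-- an ideal of a ray category -/
structure RIdeal (P : RayCategory) where
  mem : ∀ a b : P.Obj, P.Hom a b → Prop
  zero_mem : ∀ a b : P.Obj, mem a b (P.zero a b)
  comp_mem_left : ∀ {a b c : P.Obj} (g : P.Hom b c) (f : P.Hom a b),
      mem a b f → mem a c (P.comp g f)
  comp_mem_right : ∀ {a b c : P.Obj} (g : P.Hom b c) (f : P.Hom a b),
      mem b c g → mem a c (P.comp g f)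

/-- `P` is minimal representation-infinite: not locally representation-finite, but every
proper quotient (quotient by an ideal containing a nonzero morphism) is locally
representation-finite -/
def MinRepInfinite (P : RayCategory) : Prop :=
  ¬ LocRepFin P ∧ ∀ J : RIdeal P,
    (∃ (a b : P.Obj) (f : P.Hom a b), f ≠ P.zero a b ∧ J.mem a b f) →
      RepFin P Set.univ J.mem

/-- support of the indecomposable projective module `P_x` over the quotient of `P` by `I` -/
def ProjSupp (P : RayCategory) (I : ∀ a b : P.Obj, P.Hom a b → Prop) (x : P.Obj) :
    Set P.Obj :=
  {y : P.Obj | ∃ f : P.Hom x y, f ≠ P.zero x y ∧ ¬ I x y f}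

/-- support of the indecomposable injective module `I_y` over the quotient of `P` by `I` -/
def InjSupp (P : RayCategory) (I : ∀ a b : P.Obj, P.Hom a b → Prop) (y : P.Obj) :
    Set P.Obj :=
  {z : P.Obj | ∃ f : P.Hom z y, f ≠ P.zero z y ∧ ¬ I z y f}

namespace Contour

variable {P : RayCategory} {x y : P.Obj} (C : Contour P x y)

/-- points of the contour = points of the full subcategory `P(C)` -/
def points : Set P.Obj := C.v.points ∪ C.w.points

/-- the contour is non-deep -/
def NonDeep : Prop := ¬ P.IsDeep C.v.toHom

/-- the ideal generated by `π(y)v⃗`, so that `P' = P/π(y)v⃗` (transit case) -/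
def It : ∀ a b : P.Obj, P.Hom a b → Prop := IdealOf P (P.comp (P.pi y) C.v.toHom)

/-- the ideal generated by `v⃗π(x)` (cotransit case) -/
def Ic : ∀ a b : P.Obj, P.Hom a b → Prop := IdealOf P (P.comp C.v.toHom (P.pi x))

/-- decisive subcategories of `P' = P/π(y)v⃗` for `C` (transit case) -/
def DecisiveT (D : Set P.Obj) : Prop :=
  x ∈ D ∧ y ∈ D ∧ D ⊆ ProjSupp P C.It x ∪ InjSupp P C.It y

/-- decisive subcategories (cotransit case) -/
def DecisiveC (D : Set P.Obj) : Prop :=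
  x ∈ D ∧ y ∈ D ∧ D ⊆ ProjSupp P C.Ic x ∪ InjSupp P C.Ic y

/-- mildness in the transit case: `C` is non-deep, `v⃗` is transit, and every decisive
full subcategory of `P/π(y)v⃗` with at most 4 points is representation-finite -/
def MildTransit : Prop :=
  C.NonDeep ∧ P.IsTransit C.v.toHom ∧
    ∀ D : Set P.Obj, C.DecisiveT D → D.Finite → D.ncard ≤ 4 → RepFin P D C.It

/-- mildness in the cotransit case (dual) -/
def MildCotransit : Prop :=
  C.NonDeep ∧ P.IsCotransit C.v.toHom ∧
    ∀ D : Set P.Obj, C.DecisiveC D → D.Finite → D.ncard ≤ 4 → RepFin P D C.Ic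

/-- a mild contour -/
def Mild : Prop := C.MildTransit ∨ C.MildCotransit

/-- equality of contours (with possibly different endpoints), as sets `{v,w}` -/
def Same {x' y' : P.Obj} (C' : Contour P x' y') : Prop :=
  ∃ (_ : x = x') (_ : y = y'),
    (HEq C.v C'.v ∧ HEq C.w C'.w) ∨ (HEq C.v C'.w ∧ HEq C.w C'.v)

end Contour
/-- the full subcategory on `{x,y}` is a dumb-bell with loops `lam`, `rho`, arrow `mu`
and nilpotency indices `r`, `s` -/
def DumbBellData (P : RayCategory) (x y : P.Obj) (lam : P.Hom x x) (mu : P.Hom x y)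
    (rho : P.Hom y y) (r s : ℕ) : Prop :=
  x ≠ y ∧
  P.IsIrreducibleOn {x, y} lam ∧ P.IsIrreducibleOn {x, y} mu ∧ P.IsIrreducibleOn {x, y} rho ∧
  (∀ a b : P.Obj, a ∈ ({x, y} : Set P.Obj) → b ∈ ({x, y} : Set P.Obj) →
      ∀ f : P.Hom a b, P.IsIrreducibleOn {x, y} f → HEq f lam ∨ HEq f mu ∨ HEq f rho) ∧
  P.comp mu lam = P.comp rho mu ∧
  P.pow lam r = P.zero x x ∧ P.pow rho s = P.zero y y ∧
  P.pow lam (r - 1) ≠ P.zero x x ∧ P.pow rho (s - 1) ≠ P.zero y y ∧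
  min r s = 3 ∧ max r s ≤ 5 ∧
  (∀ f : P.Hom x x, ∃ i : ℕ, f = P.pow lam i) ∧
  (∀ f : P.Hom y y, ∃ i : ℕ, f = P.pow rho i) ∧
  (∀ f : P.Hom x y, f = P.zero x y ∨ ∃ i : ℕ, f = P.comp mu (P.pow lam i)) ∧
  (∀ i : ℕ, i < min r s → P.comp mu (P.pow lam i) ≠ P.zero x y) ∧
  (∀ f : P.Hom y x, f = P.zero y x)

/-- the full subcategory supported by `S` is a dumb-bell -/
def IsDumbBellOn (P : RayCategory) (S : Set P.Obj) : Prop :=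
  ∃ (x y : P.Obj) (lam : P.Hom x x) (mu : P.Hom x y) (rho : P.Hom y y) (r s : ℕ),
    DumbBellData P x y lam mu rho r s ∧ S = {x, y}

/-- the full subcategory on the points `x 0, …, x (n-1)` is a penny-farthing with arrows
`a i` (`a i = α_{i+1} : x_i → x_{i+1}`, indices mod `n`) and loop `rho` at `x 0` -/
def PennyData (P : RayCategory) (n : ℕ) (x : ℕ → P.Obj)
    (a : ∀ i : ℕ, P.Hom (x i) (x (i + 1))) (rho : P.Hom (x 0) (x 0)) : Prop :=
  1 ≤ n ∧
  (∀ i, x (i + n) = x i) ∧ (∀ i, HEq (a (i + n)) (a i)) ∧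
  (∀ i j, i < n → j < n → x i = x j → i = j) ∧
  (∀ i, P.IsIrreducibleOn (Set.range x) (a i)) ∧
  P.IsIrreducibleOn (Set.range x) rho ∧
  (∀ b c : P.Obj, b ∈ Set.range x → c ∈ Set.range x → ∀ f : P.Hom b c,
      P.IsIrreducibleOn (Set.range x) f → HEq f rho ∨ ∃ i, i < n ∧ HEq f (a i)) ∧
  -- relation α₁αₙ = 0
  P.chain x a (n - 1) 2 = P.zero (x (n - 1)) (x (n - 1 + 2)) ∧
  -- relation αₙ⋯α₁ = ρ²
  (∀ h : x (0 + n) = x 0, P.castHom rfl h (P.chain x a 0 n) = P.comp rho rho) ∧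
  -- relations 0 = α_{e i}⋯α₁ ρ αₙ⋯α_{i+1} for a non-decreasing e : {1,…,n-1} → {1,…,n}
  ∃ e : ℕ → ℕ,
    (∀ i, 1 ≤ i → i ≤ n - 1 → 1 ≤ e i ∧ e i ≤ n) ∧
    (∀ i j, 1 ≤ i → i ≤ j → j ≤ n - 1 → e i ≤ e j) ∧
    (∀ i, 1 ≤ i → i ≤ n - 1 → ∀ h : x (i + (n - i)) = x 0,
      P.comp (P.chain x a 0 (e i))
        (P.comp rho (P.castHom rfl h (P.chain x a i (n - i)))) =
      P.zero (x i) (x (0 + e i)))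

/-- the full subcategory supported by `S` is a penny-farthing -/
def IsPennyFarthingOn (P : RayCategory) (S : Set P.Obj) : Prop :=
  ∃ (n : ℕ) (x : ℕ → P.Obj) (a : ∀ i : ℕ, P.Hom (x i) (x (i + 1))) (rho : P.Hom (x 0) (x 0)),
    PennyData P n x a rho ∧ S = Set.range x

/-- the full subcategory on `{x,z,t,y}` is a diamond with arrows
`gam : x → z`, `lam : z → x`, `del : x → t`, `bet : t → y`, `alp : z → y`, `kap : y → z` -/
def DiamondData (P : RayCategory) (x z t y : P.Obj) (gam : P.Hom x z) (lam : P.Hom z x)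
    (del : P.Hom x t) (bet : P.Hom t y) (alp : P.Hom z y) (kap : P.Hom y z) : Prop :=
  (x ≠ z ∧ x ≠ t ∧ x ≠ y ∧ z ≠ t ∧ z ≠ y ∧ t ≠ y) ∧
  P.IsIrreducibleOn {x, z, t, y} gam ∧ P.IsIrreducibleOn {x, z, t, y} lam ∧
  P.IsIrreducibleOn {x, z, t, y} del ∧ P.IsIrreducibleOn {x, z, t, y} bet ∧
  P.IsIrreducibleOn {x, z, t, y} alp ∧ P.IsIrreducibleOn {x, z, t, y} kap ∧
  (∀ a b : P.Obj, a ∈ ({x, z, t, y} : Set P.Obj) → b ∈ ({x, z, t, y} : Set P.Obj) →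
      ∀ f : P.Hom a b, P.IsIrreducibleOn {x, z, t, y} f →
        HEq f gam ∨ HEq f lam ∨ HEq f del ∨ HEq f bet ∨ HEq f alp ∨ HEq f kap) ∧
  P.comp alp gam = P.comp bet del ∧
  P.comp lam kap = P.zero y x ∧
  P.comp kap alp = P.comp gam lam

/-- the full subcategory supported by `S` is a diamond -/
def IsDiamondOn (P : RayCategory) (S : Set P.Obj) : Prop :=
  ∃ (x z t y : P.Obj) (gam : P.Hom x z) (lam : P.Hom z x) (del : P.Hom x t)
    (bet : P.Hom t y) (alp : P.Hom z y) (kap : P.Hom y z),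
    DiamondData P x z t y gam lam del bet alp kap ∧ S = {x, z, t, y}

section Modules

variable {P : RayCategory} {k : Type} [Field k] {D : Set P.Obj}
  {I : ∀ a b : P.Obj, P.Hom a b → Prop}

theorem RModIso.trans {L M N : RMod P k D I} (h : RModIso L M) (h' : RModIso M N) :
    RModIso L N := by
  obtain ⟨φ, hφ⟩ := h
  obtain ⟨ψ, hψ⟩ := h'
  refine ⟨⟨fun x => (ψ.app x).comp (φ.app x), fun {x y} f => ?_⟩, fun x => ?_⟩
  · rw [← LinearMap.comp_assoc, ψ.natural, LinearMap.comp_assoc, φ.natural,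
      LinearMap.comp_assoc]
  · exact (hψ x).comp (hφ x)

namespace RMod

/-- The zero module. -/
def trivial (P : RayCategory) (k : Type) [Field k] (D : Set P.Obj)
    (I : ∀ a b : P.Obj, P.Hom a b → Prop) : RMod P k D I where
  M _ := PUnit
  act _ := 0
  act_id _ _ := Subsingleton.elim _ _
  act_comp _ _ _ _ _ := rfl
  act_zero _ _ := rfl
  supp _ _ _ := rfl
  killed _ _ := rfl

/-- The direct sum of two modules. -/
def prod (M N : RMod P k D I) : RMod P k D I where
  M x := M.M x × N.M x
  act f := (M.act f).prodMap (N.act f)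
  act_id x hx := by rw [M.act_id x hx, N.act_id x hx, LinearMap.prodMap_id]
  act_comp hx hy hz g f := by
    rw [M.act_comp hx hy hz, N.act_comp hx hy hz, LinearMap.prodMap_comp]
  act_zero hx hy := by rw [M.act_zero hx hy, N.act_zero hx hy, LinearMap.prodMap_zero]
  supp x hx m := Prod.ext (M.supp x hx _) (N.supp x hx _)
  killed f hf := by rw [M.killed f hf, N.killed f hf, LinearMap.prodMap_zero]

/-- The submodule given by a family of subspaces which is stable under the action. -/
def sub (M : RMod P k D I) (S : ∀ x, Submodule k (M.M x))
    (hS : ∀ {x y : P.Obj} (f : P.Hom x y), ∀ m ∈ S x, M.act f m ∈ S y) : RMod P k D I where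
  M x := S x
  act f := (M.act f).restrict (hS f)
  act_id x hx := by
    ext m
    simp [LinearMap.restrict_apply, M.act_id x hx]
  act_comp hx hy hz g f := by
    ext m
    simp [LinearMap.restrict_apply, M.act_comp hx hy hz]
  act_zero hx hy := by
    ext m
    simp [LinearMap.restrict_apply, M.act_zero hx hy]
  supp x hx m := Subtype.ext (M.supp x hx _)
  killed f hf := by
    ext m
    simp [LinearMap.restrict_apply, M.killed f hf]

/-- The dimension of a module over a finite full subcategory. -/
noncomputable def dim (hD : D.Finite) (M : RMod P k D I) : ℕ :=
  ∑ x ∈ hD.toFinset, Module.finrank k (M.M x)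

theorem sub_finDim {M : RMod P k D I} (hM : M.FinDim) (S : ∀ x, Submodule k (M.M x))
    (hS : ∀ {x y : P.Obj} (f : P.Hom x y), ∀ m ∈ S x, M.act f m ∈ S y) :
    (M.sub S hS).FinDim := by
  have := hM.1
  refine ⟨fun x => inferInstanceAs (FiniteDimensional k (S x)), hM.2.subset ?_⟩
  rintro x ⟨m, hm⟩
  exact ⟨m.1, fun h => hm (Subtype.ext h)⟩

theorem sub_dim_lt (hD : D.Finite) {M : RMod P k D I} (hM : M.FinDim)
    (S : ∀ x, Submodule k (M.M x))
    (hS : ∀ {x y : P.Obj} (f : P.Hom x y), ∀ m ∈ S x, M.act f m ∈ S y)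
    (h : ∃ x, S x ≠ ⊤) : (M.sub S hS).dim hD < M.dim hD := by
  have := hM.1
  obtain ⟨x, hx⟩ := h
  refine Finset.sum_lt_sum (fun y _ => Submodule.finrank_le (S y)) ⟨x, ?_, ?_⟩
  · rw [Set.Finite.mem_toFinset]
    by_contra hxD
    refine hx (Submodule.eq_top_iff'.2 fun m => ?_)
    rw [M.supp x hxD m]
    exact Submodule.zero_mem _
  · exact Submodule.finrank_lt hx

theorem prod_iso {M N M' N' : RMod P k D I} (h : RModIso M M') (h' : RModIso N N') :
    RModIso (M.prod N) (M'.prod N') := by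
  obtain ⟨φ, hφ⟩ := h
  obtain ⟨ψ, hψ⟩ := h'
  refine ⟨⟨fun x => (φ.app x).prodMap (ψ.app x), fun {x y} f => ?_⟩, fun x => ?_⟩
  · change ((M'.act f).prodMap (N'.act f)).comp _ = LinearMap.comp _ ((M.act f).prodMap (N.act f))
    rw [LinearMap.prodMap_comp, LinearMap.prodMap_comp, φ.natural, ψ.natural]
  · exact (hφ x).prodMap (hψ x)

/-- A module which is neither zero nor indecomposable splits. -/
theorem exists_split (hD : D.Finite) {M : RMod P k D I} (hM : M.FinDim) (hn : M.Nonzero)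
    (hi : ¬ M.Indec) : ∃ A B : RMod P k D I, A.FinDim ∧ B.FinDim ∧
      A.dim hD < M.dim hD ∧ B.dim hD < M.dim hD ∧ RModIso (A.prod B) M := by
  have : ∃ e : RModHom M M, (∀ x, (e.app x).comp (e.app x) = e.app x) ∧
      (∃ x, e.app x ≠ 0) ∧ ∃ x, e.app x ≠ LinearMap.id := by
    by_contra hcon
    refine hi ⟨hn, fun e he => ?_⟩
    by_contra h2
    push Not at h2
    exact hcon ⟨e, he, h2.1, h2.2⟩
  obtain ⟨e, he, h0, h1⟩ := this
  have hee : ∀ x m, e.app x (e.app x m) = e.app x m := fun x m => LinearMap.congr_fun (he x) m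
  have hnat : ∀ {x y : P.Obj} (f : P.Hom x y) (m : M.M x),
      M.act f (e.app x m) = e.app y (M.act f m) := fun f m => LinearMap.congr_fun (e.natural f) m
  have hA : ∀ {x y : P.Obj} (f : P.Hom x y), ∀ m ∈ LinearMap.range (e.app x),
      M.act f m ∈ LinearMap.range (e.app y) := by
    rintro x y f _ ⟨m, rfl⟩
    exact ⟨M.act f m, (hnat f m).symm⟩
  have hB : ∀ {x y : P.Obj} (f : P.Hom x y), ∀ m ∈ LinearMap.ker (e.app x),
      M.act f m ∈ LinearMap.ker (e.app y) := by
    intro x y f m hm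
    rw [LinearMap.mem_ker] at hm ⊢
    rw [← hnat, hm, map_zero]
  refine ⟨M.sub _ hA, M.sub _ hB, sub_finDim hM _ _, sub_finDim hM _ _,
    sub_dim_lt hD hM _ _ ?_, sub_dim_lt hD hM _ _ ?_, ?_⟩
  · obtain ⟨x, hx⟩ := h1
    refine ⟨x, fun htop => hx ?_⟩
    ext m
    obtain ⟨m', rfl⟩ := LinearMap.range_eq_top.1 htop m
    exact hee x m'
  · obtain ⟨x, hx⟩ := h0
    exact ⟨x, fun htop => hx (LinearMap.ker_eq_top.1 htop)⟩
  · refine ⟨⟨fun x => (Submodule.subtype _).coprod (Submodule.subtype _), fun {x y} f => ?_⟩,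
      fun x => ⟨?_, ?_⟩⟩
    · refine LinearMap.ext fun m => ?_
      exact (M.act f).map_add _ _
    · refine (injective_iff_map_eq_zero (LinearMap.coprod (Submodule.subtype _) (Submodule.subtype _))).2 ?_
      rintro ⟨⟨_, m, rfl⟩, ⟨m', hm'⟩⟩ h
      replace h : e.app x m + m' = 0 := h
      rw [LinearMap.mem_ker] at hm'
      have h2 : e.app x m = 0 := by
        have := congrArg (e.app x) h
        rwa [map_add, hee, hm', add_zero, map_zero] at this
      have h3 : m' = 0 := by rwa [h2, zero_add] at h
      exact Prod.ext (Subtype.ext h2) (Subtype.ext h3)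
    · intro m
      refine ⟨(⟨e.app x m, m, rfl⟩, ⟨m - e.app x m, ?_⟩), ?_⟩
      · rw [LinearMap.mem_ker, map_sub, hee, sub_self]
      · exact add_sub_cancel _ _

end RMod

/-- Over a representation-finite full subcategory with finitely many points there are only
finitely many isomorphism classes of modules of bounded dimension. -/
theorem RepFin.finite_bounded_dim (hD : D.Finite) (h : RepFin P D I) (N : ℕ) :
    ∃ (ι : Type) (_ : Finite ι) (rep : ι → RMod P k D I),
      ∀ M : RMod P k D I, M.FinDim → M.dim hD < N → ∃ i, RModIso (rep i) M := by
  induction N with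
  | zero => exact ⟨Empty, inferInstance, fun e => e.elim, fun M _ hM => absurd hM (by simp)⟩
  | succ N ih =>
    obtain ⟨ι, _, rep, hrep⟩ := ih
    choose κ hκ r hr using fun x => h k x
    have := hD.to_subtype
    refine ⟨Unit ⊕ (Σ x : D, κ x) ⊕ (ι × ι), inferInstance,
      Sum.elim (fun _ => RMod.trivial P k D I)
        (Sum.elim (fun i => r i.1 i.2) fun i => (rep i.1).prod (rep i.2)), fun M hM hd => ?_⟩
    by_cases hn : M.Nonzero
    · by_cases hi : M.Indec
      · obtain ⟨x, m, hm⟩ := hn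
        have hx : x ∈ D := by
          by_contra hx
          exact hm (M.supp x hx m)
        obtain ⟨i, hi⟩ := hr x M hM hi ⟨m, hm⟩
        exact ⟨Sum.inr (Sum.inl ⟨⟨x, hx⟩, i⟩), hi⟩
      · obtain ⟨A, B, hA, hB, hAd, hBd, hAB⟩ := RMod.exists_split hD hM hn hi
        obtain ⟨i, hi⟩ := hrep A hA (by lia)
        obtain ⟨j, hj⟩ := hrep B hB (by lia)
        exact ⟨Sum.inr (Sum.inr (i, j)), (RMod.prod_iso hi hj).trans hAB⟩
    · have h0 : ∀ x (m : M.M x), m = 0 := by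
        intro x m
        by_contra hm
        exact hn ⟨x, m, hm⟩
      refine ⟨Sum.inl (), ⟨fun x => 0, fun f => ?_⟩, fun x => ⟨?_, ?_⟩⟩
      · rw [LinearMap.comp_zero, LinearMap.zero_comp]
      · intro _ _ _
        rfl
      · intro m
        exact ⟨PUnit.unit, (h0 x _).trans (h0 x m).symm⟩

end Modules

namespace RayCategory

/-- A module over the full subcategory on the points `X i`, given by a representation `T`
indexed by `ι`. -/
noncomputable def ofIndexed (P : RayCategory) (I : ∀ a b : P.Obj, P.Hom a b → Prop)
    {ι : Type} [Fintype ι] (X : ι → P.Obj) (hX : Function.Injective X) (W : ι → Type)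
    [∀ i, AddCommGroup (W i)] [∀ i, Module ℚ (W i)]
    (T : ∀ i j, P.Hom (X i) (X j) → (W i →ₗ[ℚ] W j))
    (hid : ∀ i, T i i (P.id (X i)) = LinearMap.id)
    (hcomp : ∀ i j k (g : P.Hom (X j) (X k)) (f : P.Hom (X i) (X j)),
      T i k (P.comp g f) = (T j k g).comp (T i j f))
    (hzero : ∀ i j, T i j (P.zero _ _) = 0)
    (hI : ∀ i j f, I _ _ f → T i j f = 0) : RMod P ℚ (Set.range X) I := by
  classical
  have hu : ∀ i, Subsingleton {j // X j = X i} := fun i =>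
    ⟨fun a b => Subtype.ext (hX (a.2.trans b.2.symm))⟩
  exact
  { M := fun p => ∀ i : {i // X i = p}, W i
    act := fun {p q} f => LinearMap.pi fun j : {j // X j = q} =>
      ∑ i : {i // X i = p}, (T i j (P.castHom i.2.symm j.2.symm f)).comp (LinearMap.proj i)
    act_id := by
      rintro _ ⟨i, rfl⟩
      refine LinearMap.ext fun m => funext ?_
      rintro ⟨j, hj⟩
      obtain rfl := hX hj
      have := hu j
      simp [Fintype.sum_subsingleton _ (⟨j, rfl⟩ : {i // X i = X j}), castHom, hid]
    act_comp := by
      rintro _ _ _ ⟨i, rfl⟩ ⟨j, rfl⟩ ⟨k, rfl⟩ g f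
      have := hu i
      have := hu j
      refine LinearMap.ext fun m => funext ?_
      rintro ⟨k', hk⟩
      obtain rfl := hX hk
      simp [Fintype.sum_subsingleton _ (⟨i, rfl⟩ : {a // X a = X i}),
        Fintype.sum_subsingleton _ (⟨j, rfl⟩ : {a // X a = X j}), castHom, hcomp]
    act_zero := by
      rintro _ _ ⟨i, rfl⟩ ⟨j, rfl⟩
      have := hu i
      refine LinearMap.ext fun m => funext ?_
      rintro ⟨j', hj⟩
      obtain rfl := hX hj
      simp [Fintype.sum_subsingleton _ (⟨i, rfl⟩ : {a // X a = X i}), castHom, hzero]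
    supp := fun p hp m => funext fun i => absurd ⟨i.1, i.2⟩ hp
    killed := by
      intro p q f hf
      refine LinearMap.ext fun m => funext ?_
      rintro ⟨j, rfl⟩
      simp only [LinearMap.pi_apply, LinearMap.zero_apply, Pi.zero_apply]
      rw [LinearMap.sum_apply]
      refine Finset.sum_eq_zero ?_
      rintro ⟨i, rfl⟩ -
      simp [castHom, hI _ _ _ hf] }

/-- A one-parameter family of pairwise non-isomorphic modules of the same dimension
excludes representation-finiteness. -/
theorem not_repFin_of_family (P : RayCategory) (I : ∀ a b : P.Obj, P.Hom a b → Prop)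
    {ι : Type} [Fintype ι] (X : ι → P.Obj) (hX : Function.Injective X) (W : ι → Type)
    [∀ i, AddCommGroup (W i)] [∀ i, Module ℚ (W i)] [∀ i, FiniteDimensional ℚ (W i)]
    (T : ℚ → ∀ i j, P.Hom (X i) (X j) → (W i →ₗ[ℚ] W j))
    (hid : ∀ c i, T c i i (P.id (X i)) = LinearMap.id)
    (hcomp : ∀ c i j k (g : P.Hom (X j) (X k)) (f : P.Hom (X i) (X j)),
      T c i k (P.comp g f) = (T c j k g).comp (T c i j f))
    (hzero : ∀ c i j, T c i j (P.zero _ _) = 0)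
    (hI : ∀ c i j f, I _ _ f → T c i j f = 0)
    (hiso : ∀ (c c' : ℚ) (φ : ∀ i, W i →ₗ[ℚ] W i), (∀ i, Function.Injective (φ i)) →
      (∀ i j (f : P.Hom (X i) (X j)) w, T c' i j f (φ i w) = φ j (T c i j f w)) → c = c') :
    ¬ RepFin P (Set.range X) I := by
  classical
  intro hrep
  have hD : (Set.range X).Finite := Set.finite_range X
  let M : ℚ → RMod P ℚ (Set.range X) I := fun c =>
    P.ofIndexed I X hX W (T c) (hid c) (hcomp c) (hzero c) (hI c)
  let N := ∑ x ∈ hD.toFinset, Module.finrank ℚ (∀ i : {i // X i = x}, W i)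
  obtain ⟨κ, _, rep, hr⟩ := hrep.finite_bounded_dim (k := ℚ) hD (N + 1)
  have hfd : ∀ c, (M c).FinDim := by
    intro c
    refine ⟨fun x => inferInstanceAs (FiniteDimensional ℚ (∀ i : {i // X i = x}, W i)),
      hD.subset ?_⟩
    rintro x ⟨m, hm⟩
    by_contra hx
    exact hm ((M c).supp x hx m)
  choose i hi using fun c => hr (M c) (hfd c) (Nat.lt_succ_self N)
  obtain ⟨c, c', hne, hcc⟩ := Finite.exists_ne_map_eq_of_infinite i
  refine hne ?_
  obtain ⟨φ, hφ⟩ := hi c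
  have hc' := hi c'
  rw [← hcc] at hc'
  obtain ⟨ψ, hψ⟩ := hc'
  let e : ∀ x, (rep (i c)).M x ≃ₗ[ℚ] (M c).M x := fun x => LinearEquiv.ofBijective _ (hφ x)
  have hu : ∀ i, Subsingleton {j // X j = X i} := fun i =>
    ⟨fun a b => Subtype.ext (hX (a.2.trans b.2.symm))⟩
  let un : ∀ i, Unique {j // X j = X i} := fun i => ⟨⟨⟨i, rfl⟩⟩, fun _ => Subsingleton.elim _ _⟩
  let L : ∀ d i, (M d).M (X i) ≃ₗ[ℚ] W i := fun d i =>
    LinearEquiv.piUnique ℚ (fun j : {j // X j = X i} => W j)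
  have hL : ∀ (d : ℚ) (a b : ι) (f : P.Hom (X a) (X b)) (m : (M d).M (X a)),
      L d b ((M d).act f m) = T d a b f (L d a m) := by
    intro d a b f m
    have := hu a
    change (∑ i : {i // X i = X a}, (T d i b (P.castHom i.2.symm rfl f)).comp
      (LinearMap.proj i)) m = _
    rw [Fintype.sum_subsingleton _ (⟨a, rfl⟩ : {i // X i = X a})]
    rfl
  refine hiso c c' (fun a => ((L c' a).toLinearMap.comp ((ψ.app (X a)).comp
    (e (X a)).symm.toLinearMap)).comp (L c a).symm.toLinearMap) (fun a => ?_) ?_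
  · exact (((L c' a).injective.comp (hψ (X a)).1).comp (e (X a)).symm.injective).comp
      (L c a).symm.injective
  · intro a b f w
    obtain ⟨m, rfl⟩ := (L c a).surjective w
    obtain ⟨m', rfl⟩ := (e (X a)).surjective m
    have h1 : (M c).act f (e (X a) m') = e (X b) ((rep (i c)).act f m') :=
      LinearMap.congr_fun (φ.natural f) m'
    have h2 : (M c').act f (ψ.app (X a) m') = ψ.app (X b) ((rep (i c)).act f m') :=
      LinearMap.congr_fun (ψ.natural f) m'
    change T c' a b f (L c' a (ψ.app (X a) ((e (X a)).symm ((L c a).symm (L c a _))))) =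
      L c' b (ψ.app (X b) ((e (X b)).symm ((L c b).symm (T c a b f (L c a _)))))
    rw [← hL c, LinearEquiv.symm_apply_apply, LinearEquiv.symm_apply_apply, h1,
      LinearEquiv.symm_apply_apply, LinearEquiv.symm_apply_apply, ← h2, hL]

end RayCategory

namespace RayCategory

variable {P : RayCategory}

theorem pipow_add (x : P.Obj) (i j : ℕ) :
    P.pipow x (i + j) = P.comp (P.pipow x i) (P.pipow x j) := by
  induction i with
  | zero => rw [Nat.zero_add, P.pipow_zero, P.id_comp]
  | succ i ih => rw [Nat.add_right_comm, P.pipow_succ, ih, P.pipow_succ x i, P.assoc]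

theorem pipow_eq_zero {x : P.Obj} {i : ℕ} (h : P.nilp x ≤ i) : P.pipow x i = P.zero x x := by
  obtain ⟨j, rfl⟩ := Nat.exists_eq_add_of_le h
  rw [pipow_add, P.pipow_nilp, P.zero_comp]

theorem pipow_mono_zero {x : P.Obj} {i j : ℕ} (h : i ≤ j) (hi : P.pipow x i = P.zero x x) :
    P.pipow x j = P.zero x x := by
  obtain ⟨j, rfl⟩ := Nat.exists_eq_add_of_le h
  rw [pipow_add, hi, P.zero_comp]

theorem comp_pipow_iterate {x y : P.Obj} {f : P.Hom x y} {i j : ℕ}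
    (h : f = P.comp (P.pipow y i) (P.comp f (P.pipow x j))) (m : ℕ) :
    f = P.comp (P.pipow y (m * i)) (P.comp f (P.pipow x (m * j))) := by
  induction m with
  | zero => rw [Nat.zero_mul, Nat.zero_mul, P.pipow_zero, P.pipow_zero, P.comp_id, P.id_comp]
  | succ m ih =>
    rw [Nat.succ_mul, Nat.succ_mul, pipow_add, Nat.add_comm _ j, pipow_add]
    calc f = P.comp (P.pipow y (m * i)) (P.comp f (P.pipow x (m * j))) := ih
      _ = P.comp (P.pipow y (m * i)) (P.comp
        (P.comp (P.pipow y i) (P.comp f (P.pipow x j))) (P.pipow x (m * j))) := by rw [← h]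
      _ = _ := by simp only [P.assoc]

/-- A morphism absorbed by nontrivial powers of the generators of the radicals vanishes. -/
theorem eq_zero_of_absorb {x y : P.Obj} {f : P.Hom x y} {i j : ℕ} (hij : 1 ≤ i + j)
    (h : f = P.comp (P.pipow y i) (P.comp f (P.pipow x j))) : f = P.zero x y := by
  rcases Nat.eq_zero_or_pos i with rfl | hi
  · rw [comp_pipow_iterate h (P.nilp x), pipow_eq_zero (x := x) (by nlinarith),
      P.comp_zero, P.comp_zero]
  · rw [comp_pipow_iterate h (P.nilp y), pipow_eq_zero (x := y) (by nlinarith), P.zero_comp]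

theorem eq_zero_of_absorb_left {x y : P.Obj} {f : P.Hom x y} {i : ℕ} (hi : 1 ≤ i)
    (h : f = P.comp (P.pipow y i) f) : f = P.zero x y :=
  eq_zero_of_absorb (i := i) (j := 0) hi (by rw [P.pipow_zero, P.comp_id, ← h])

theorem eq_zero_of_absorb_right {x y : P.Obj} {f : P.Hom x y} {j : ℕ} (hj : 1 ≤ j)
    (h : f = P.comp f (P.pipow x j)) : f = P.zero x y :=
  eq_zero_of_absorb (i := 0) (j := j) (by lia) (by rw [P.pipow_zero, P.id_comp, ← h])

theorem pipow_injective {x : P.Obj} {i j : ℕ} (h : P.pipow x i = P.pipow x j)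
    (hi : P.pipow x i ≠ P.zero x x) : i = j := by
  have key : ∀ a b : ℕ, a < b → P.pipow x a = P.pipow x b → P.pipow x a = P.zero x x := by
    intro a b hab h
    obtain ⟨d, rfl⟩ := Nat.exists_eq_add_of_le' hab.le
    exact eq_zero_of_absorb_left (i := d) (by lia) (by rw [← pipow_add, ← h])
  rcases lt_trichotomy i j with hij | hij | hij
  · exact absurd (key i j hij h) hi
  · exact hij
  · exact absurd (h.trans (key j i hij h.symm)) hi

theorem id_ne_zero (x : P.Obj) : P.id x ≠ P.zero x x := by
  intro h
  refine P.pipow_nilp_ne x (pipow_mono_zero (Nat.zero_le _) ?_)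
  rw [P.pipow_zero, h]

theorem isId_iff {x : P.Obj} {f : P.Hom x x} : P.IsId f ↔ f = P.id x :=
  ⟨fun ⟨_, h⟩ => eq_of_heq h, fun h => ⟨rfl, heq_of_eq h⟩⟩

theorem not_isId_of_ne {x y : P.Obj} (h : x ≠ y) (f : P.Hom x y) : ¬ P.IsId f :=
  fun h' => h h'.1

theorem eq_pipow_of_not_isId {x : P.Obj} {f : P.Hom x x} (h : ¬ P.IsId f) :
    ∃ i, f = P.comp (P.pipow x i) (P.pipow x 1) := by
  obtain ⟨i, rfl⟩ := P.endo_cyclic x f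
  cases i with
  | zero => exact absurd (isId_iff.2 (P.pipow_zero x)) h
  | succ i => exact ⟨i, pipow_add x i 1⟩

/-- One-sided invertible morphisms are identities. -/
theorem eq_of_comp_eq_id {x y : P.Obj} {f : P.Hom x y} {g : P.Hom y x}
    (h : P.comp g f = P.id x) : x = y := by
  obtain ⟨i, hi⟩ := P.endo_cyclic y (P.comp f g)
  have hidem : P.pipow y (i + i) = P.pipow y i := by
    rw [pipow_add, ← hi, P.assoc, ← P.assoc g, h, P.id_comp]
  have hne : P.pipow y i ≠ P.zero y y := by
    intro h0
    apply id_ne_zero x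
    calc P.id x = P.comp (P.comp g f) (P.comp g f) := by rw [h, P.id_comp]
      _ = P.comp g (P.comp (P.comp f g) f) := by simp only [P.assoc]
      _ = P.zero x x := by rw [hi, h0, P.zero_comp, P.comp_zero]
  have := pipow_injective hidem.symm hne
  obtain rfl : i = 0 := by lia
  exact P.no_iso f g h (by rw [hi, P.pipow_zero])

theorem isId_of_comp {x y z : P.Obj} {f : P.Hom x y} {g : P.Hom y z}
    (h : P.IsId (P.comp g f)) : P.IsId g ∧ P.IsId f := by
  obtain ⟨hxz, h⟩ := h
  subst hxz
  have h := eq_of_heq h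
  obtain rfl := eq_of_comp_eq_id h
  obtain ⟨i, rfl⟩ := P.endo_cyclic x f
  obtain ⟨j, rfl⟩ := P.endo_cyclic x g
  rw [← pipow_add, ← P.pipow_zero] at h
  have := pipow_injective h.symm (by rw [P.pipow_zero]; exact id_ne_zero x)
  obtain rfl : i = 0 := by lia
  obtain rfl : j = 0 := by lia
  exact ⟨isId_iff.2 (P.pipow_zero x), isId_iff.2 (P.pipow_zero x)⟩

open Classical in
/-- Representations on which all products of two non-identities vanish. -/
theorem not_repFin_of_radical_square_zero (I : ∀ a b : P.Obj, P.Hom a b → Prop)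
    {ι : Type} [Fintype ι] (X : ι → P.Obj) (hX : Function.Injective X) (U : Type)
    [AddCommGroup U] [Module ℚ U] [FiniteDimensional ℚ U]
    (active : ι → ι → Prop) (β : ∀ i j, P.Hom (X i) (X j))
    (A : ℚ → ι → ι → (U →ₗ[ℚ] U))
    (hirr : ∀ i j, active i j → P.IsIrreducibleOn (Set.range X) (β i j))
    (hI : ∀ i j, active i j → ¬ I _ _ (β i j)) (hid : ∀ i, ¬ I _ _ (P.id (X i)))
    (hiso : ∀ (c c' : ℚ) (φ : ι → (U × U →ₗ[ℚ] U × U)), (∀ i, Function.Injective (φ i)) →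
      (∀ i j, active i j → ∀ w : U × U,
        ((0 : U), A c' i j (φ i w).1) = φ j ((0 : U), A c i j w.1)) → c = c') :
    ¬ RepFin P (Set.range X) I := by
  let T : ℚ → ∀ i j, P.Hom (X i) (X j) → (U × U →ₗ[ℚ] U × U) := fun c i j g =>
    if P.IsId g then LinearMap.id else
      if active i j ∧ g = β i j then
        (LinearMap.inr ℚ U U).comp ((A c i j).comp (LinearMap.fst ℚ U U)) else 0
  have hTid : ∀ c i j g, P.IsId g → T c i j g = LinearMap.id := fun c i j g h => if_pos h
  have hTβ : ∀ c i j, active i j → T c i j (β i j) =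
      (LinearMap.inr ℚ U U).comp ((A c i j).comp (LinearMap.fst ℚ U U)) := fun c i j h =>
    (if_neg (hirr i j h).2.1).trans (if_pos ⟨h, rfl⟩)
  have hT0 : ∀ c i j g, ¬ P.IsId g → ¬ (active i j ∧ g = β i j) → T c i j g = 0 :=
    fun c i j g h h' => (if_neg h).trans (if_neg h')
  have hidzero : ∀ i j, ¬ P.IsId (P.zero (X i) (X j)) := by
    rintro i j ⟨h, h'⟩
    obtain rfl := hX h
    exact id_ne_zero _ (eq_of_heq h').symm
  refine P.not_repFin_of_family I X hX (fun _ => U × U) T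
    (fun c i => hTid _ _ _ _ ⟨rfl, HEq.rfl⟩) ?_ ?_ ?_ ?_
  · intro c i j k g f
    by_cases hg : P.IsId g
    · rw [hTid c j k g hg]
      obtain ⟨h, hg⟩ := hg
      obtain rfl := hX h
      obtain rfl := eq_of_heq hg
      rw [P.id_comp]
      rfl
    by_cases hf : P.IsId f
    · rw [hTid c i j f hf]
      obtain ⟨h, hf⟩ := hf
      obtain rfl := hX h
      obtain rfl := eq_of_heq hf
      rw [P.comp_id]
      rfl
    rw [hT0 c i k (P.comp g f) (fun h => hg (isId_of_comp h).1)]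
    · have hfst : ∀ w, (T c i j f w).1 = 0 := by
        intro w
        by_cases h : active i j ∧ f = β i j
        · rw [h.2, hTβ c i j h.1]
          rfl
        · rw [hT0 c i j f hf h]
          rfl
      refine LinearMap.ext fun w => ?_
      by_cases h : active j k ∧ g = β j k
      · rw [h.2, hTβ c j k h.1]
        simp [hfst, ← Prod.zero_eq_mk]
      · rw [hT0 c j k g hg h]
        rfl
    · rintro ⟨h, h'⟩
      rcases (hirr i k h).2.2 (X j) ⟨j, rfl⟩ g f h'.symm with h | h
      · exact hg h
      · exact hf h
  · intro c i j
    exact hT0 c i j _ (hidzero i j) fun h => (hirr i j h.1).1 h.2.symm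
  · intro c i j f hf
    refine hT0 c i j f ?_ fun h => hI i j h.1 (h.2 ▸ hf)
    rintro ⟨h, h'⟩
    obtain rfl := hX h
    obtain rfl := eq_of_heq h'
    exact hid _ hf
  · intro c c' φ hφ hn
    refine hiso c c' φ hφ fun i j h w => ?_
    have := hn i j (β i j) w
    rw [hTβ c i j h, hTβ c' i j h] at this
    exact this

/-- Two points, each with an irreducible loop, and irreducible morphisms in both directions. -/
theorem not_repFin_two_loops (I : ∀ a b : P.Obj, P.Hom a b → Prop) {o z : P.Obj} (hoz : o ≠ z)
    (r : P.Hom o o) (p : P.Hom o z) (q : P.Hom z o) (t : P.Hom z z)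
    (hr : P.IsIrreducibleOn {o, z} r) (hp : P.IsIrreducibleOn {o, z} p)
    (hq : P.IsIrreducibleOn {o, z} q) (ht : P.IsIrreducibleOn {o, z} t)
    (hrI : ¬ I _ _ r) (hpI : ¬ I _ _ p) (hqI : ¬ I _ _ q) (htI : ¬ I _ _ t)
    (ho : ¬ I _ _ (P.id o)) (hz : ¬ I _ _ (P.id z)) : ¬ RepFin P {o, z} I := by
  let X : Bool → P.Obj := fun b => match b with | false => o | true => z
  have hXr : Set.range X = {o, z} := by
    ext y
    simp only [Set.mem_range, Bool.exists_bool, Set.mem_insert_iff, Set.mem_singleton_iff]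
    exact or_congr eq_comm eq_comm
  let β : ∀ i j, P.Hom (X i) (X j) := fun i j => match i, j with
    | false, false => r
    | false, true => p
    | true, false => q
    | true, true => t
  rw [← hXr] at hr hp hq ht ⊢
  refine not_repFin_of_radical_square_zero I X ?_ ℚ (fun _ _ => True) β
    (fun c i j => (bif i && j then c else 1) • LinearMap.id) ?_ ?_ ?_ ?_
  · rintro (_ | _) (_ | _) h
    · rfl
    · exact absurd h hoz
    · exact absurd h.symm hoz
    · rfl
  · rintro (_ | _) (_ | _) - <;> assumption
  · rintro (_ | _) (_ | _) - <;> assumption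
  · rintro (_ | _) <;> assumption
  · intro c c' φ hφ hn
    have h00 := hn false false trivial (1, 0)
    have h01 := hn false true trivial (1, 0)
    have h10 := hn true false trivial (1, 0)
    have h11 := hn true true trivial (1, 0)
    simp only [Bool.and_self, Bool.and_false, Bool.false_and, cond_false, cond_true, one_smul,
      LinearMap.id_apply, LinearMap.smul_apply, smul_eq_mul, mul_one] at h00 h01 h10 h11
    have e : ((0 : ℚ), c) = c • ((0 : ℚ), (1 : ℚ)) := by simp
    rw [e, map_smul, ← h01] at h11
    rw [← h00] at h10
    have e1 := congrArg Prod.snd h10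
    have e2 := congrArg Prod.snd h11
    simp only [Prod.smul_snd, smul_eq_mul] at e1 e2
    rw [e1] at e2
    have hne : (φ false (1, 0)).1 ≠ 0 := by
      intro h
      rw [h] at h00
      have := hφ false (h00.symm.trans (map_zero (φ false)).symm)
      simp at this
    exact (mul_right_cancel₀ hne e2).symm

/-- Three points with an irreducible loop at the first one, which is connected to the other
two by irreducible morphisms in both directions. -/
theorem not_repFin_star (I : ∀ a b : P.Obj, P.Hom a b → Prop) {o z y : P.Obj} (hoz : o ≠ z)
    (hoy : o ≠ y) (hzy : z ≠ y) (r : P.Hom o o) (p : P.Hom o z) (q : P.Hom z o)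
    (p' : P.Hom o y) (q' : P.Hom y o)
    (hr : P.IsIrreducibleOn {o, z, y} r) (hp : P.IsIrreducibleOn {o, z, y} p)
    (hq : P.IsIrreducibleOn {o, z, y} q) (hp' : P.IsIrreducibleOn {o, z, y} p')
    (hq' : P.IsIrreducibleOn {o, z, y} q')
    (hrI : ¬ I _ _ r) (hpI : ¬ I _ _ p) (hqI : ¬ I _ _ q) (hpI' : ¬ I _ _ p')
    (hqI' : ¬ I _ _ q') (ho : ¬ I _ _ (P.id o)) (hz : ¬ I _ _ (P.id z))
    (hy : ¬ I _ _ (P.id y)) : ¬ RepFin P {o, z, y} I := by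
  let X : Option Bool → P.Obj := fun b => match b with
    | none => o
    | some false => z
    | some true => y
  have hXr : Set.range X = {o, z, y} := by
    ext w
    simp only [Set.mem_range, Option.exists, Bool.exists_bool, Set.mem_insert_iff,
      Set.mem_singleton_iff]
    exact or_congr eq_comm (or_congr eq_comm eq_comm)
  let β : ∀ i j, P.Hom (X i) (X j) := fun i j => match i, j with
    | none, none => r
    | none, some false => p
    | none, some true => p'
    | some false, none => q
    | some true, none => q'
    | some _, some _ => P.zero _ _
  let A : ℚ → Option Bool → Option Bool → (ℚ × ℚ →ₗ[ℚ] ℚ × ℚ) := fun c i j => match i, j with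
    | none, none => LinearMap.id
    | none, some false => (LinearMap.fst ℚ ℚ ℚ).prod 0
    | none, some true => (LinearMap.snd ℚ ℚ ℚ).prod 0
    | some false, none => (LinearMap.fst ℚ ℚ ℚ).prod (LinearMap.fst ℚ ℚ ℚ)
    | some true, none => (LinearMap.fst ℚ ℚ ℚ).prod (c • LinearMap.fst ℚ ℚ ℚ)
    | some _, some _ => 0
  rw [← hXr] at hr hp hq hp' hq' ⊢
  refine not_repFin_of_radical_square_zero I X ?_ (ℚ × ℚ) (fun i j => i = none ∨ j = none) β
    A ?_ ?_ ?_ ?_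
  · rintro (_ | _ | _) (_ | _ | _) h
    · rfl
    · exact absurd h hoz
    · exact absurd h hoy
    · exact absurd h.symm hoz
    · rfl
    · exact absurd h hzy
    · exact absurd h.symm hoy
    · exact absurd h.symm hzy
    · rfl
  · rintro (_ | _ | _) (_ | _ | _) h <;> first | assumption | simp at h
  · rintro (_ | _ | _) (_ | _ | _) h <;> first | assumption | simp at h
  · rintro (_ | _ | _) <;> assumption
  · intro c c' φ hφ hn
    have hoo : ∀ x : ℚ × ℚ, φ none (0, x) = (0, (φ none (x, 0)).1) :=
      fun x => (hn none none (Or.inl rfl) (x, 0)).symm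
    have hz1 : (0, ((φ none ((0, 1), 0)).1.1, (0 : ℚ))) = φ (some false) 0 :=
      hn none (some false) (Or.inl rfl) ((0, 1), 0)
    have hy1 : (0, ((φ none ((1, 0), 0)).1.2, (0 : ℚ))) = φ (some true) 0 :=
      hn none (some true) (Or.inl rfl) ((1, 0), 0)
    have hz2 := hn (some false) none (Or.inr rfl) ((1, 0), 0)
    have hy2 := hn (some true) none (Or.inr rfl) ((1, 0), 0)
    change (0, ((φ (some false) ((1, 0), 0)).1.1, (φ (some false) ((1, 0), 0)).1.1)) =
      φ none (0, (1, 1)) at hz2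
    change (0, ((φ (some true) ((1, 0), 0)).1.1, c' * (φ (some true) ((1, 0), 0)).1.1)) =
      φ none (0, (1, c * 1)) at hy2
    have e1 : ((0 : ℚ × ℚ), ((1 : ℚ), c * 1)) = (0, (1, 0)) + c • (0, (0, 1)) := by simp
    have e2 : ((0 : ℚ × ℚ), ((1 : ℚ), (1 : ℚ))) = (0, (1, 0)) + (0, (0, 1)) := by simp
    rw [e1, map_add, map_smul, hoo, hoo] at hy2
    rw [e2, map_add, hoo, hoo] at hz2
    rw [map_zero] at hz1 hy1
    simp only [Prod.mk_eq_zero, and_true, true_and] at hz1 hy1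
    simp only [Prod.ext_iff, Prod.snd_add, Prod.smul_snd, Prod.fst_add, Prod.smul_fst, hz1, hy1,
      smul_eq_mul] at hz2 hy2
    have hne : (φ none ((1, 0), 0)).1.1 ≠ 0 := by
      intro h
      have h2 := hoo (1, 0)
      have h3 : (φ none ((1, 0), 0)).1 = 0 := Prod.ext h hy1
      rw [h3] at h2
      have := hφ none (h2.trans (map_zero (φ none)).symm)
      simp at this
    obtain ⟨-, a1, a2⟩ := hz2
    obtain ⟨-, b1, b2⟩ := hy2
    refine mul_right_cancel₀ hne ?_
    linear_combination c' * b1 - b2 - c * a1 + c * a2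

end RayCategory

namespace RayCategory

variable {P : RayCategory}

theorem comp_pipow_injective {o j : P.Obj} {v : P.Hom o j} {d e : ℕ}
    (h : P.comp v (P.pipow o d) = P.comp v (P.pipow o e))
    (h0 : P.comp v (P.pipow o d) ≠ P.zero o j) : d = e := by
  have key : ∀ a b : ℕ, a < b → P.comp v (P.pipow o a) = P.comp v (P.pipow o b) →
      P.comp v (P.pipow o a) = P.zero o j := by
    intro a b hab h
    obtain ⟨c, rfl⟩ := Nat.exists_eq_add_of_le hab.le
    exact eq_zero_of_absorb_right (j := c) (by lia) (by rw [P.assoc, ← pipow_add, ← h])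
  rcases lt_trichotomy d e with hij | hij | hij
  · exact absurd (key d e hij h) h0
  · exact hij
  · exact absurd (h.trans (key e d hij h.symm)) h0

open Classical in
/-- Representations defined through labels: a morphism `g : X i → X j` has label `d` if it
maps the chosen morphism `v i : o → X i` to `v j * π(o) ^ d ≠ 0`.  The action of `g` depends
only on its label. -/
theorem not_repFin_of_labels (I : ∀ a b : P.Obj, P.Hom a b → Prop)
    {ι : Type} [Fintype ι] (X : ι → P.Obj) (hX : Function.Injective X) (o : P.Obj)
    (v : ∀ i, P.Hom o (X i)) (b : ι → ℕ) (hb : ∀ i, 0 < b i)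
    (hne : ∀ j d, d < b j → P.comp (v j) (P.pipow o d) ≠ P.zero _ _)
    (hleft : ∀ i k (t : P.Hom o (X i)) (h : P.Hom (X i) (X k)) e, e < b k →
      P.comp h t = P.comp (v k) (P.pipow o e) → ∃ d < b i, t = P.comp (v i) (P.pipow o d))
    (hright : ∀ j (t : P.Hom o (X j)) d e, e < b j →
      P.comp t (P.pipow o d) = P.comp (v j) (P.pipow o e) →
        ∃ d', t = P.comp (v j) (P.pipow o d'))
    (W : ι → Type) [∀ i, AddCommGroup (W i)] [∀ i, Module ℚ (W i)]
    [∀ i, FiniteDimensional ℚ (W i)]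
    (A : ℚ → ∀ i j, ℕ → (W i →ₗ[ℚ] W j)) (allowed : ι → ι → ℕ → Prop)
    (hallowed : ∀ i j (g : P.Hom (X i) (X j)) d, d < b j →
      P.comp g (v i) = P.comp (v j) (P.pipow o d) → allowed i j d)
    (hid : ∀ c i, A c i i 0 = LinearMap.id)
    (hbig : ∀ c i j d, b j ≤ d → A c i j d = 0)
    (hlaw : ∀ c i j k d e, d < b j → e < b k → allowed i j d → allowed j k e →
      A c i k (e + d) = (A c j k e).comp (A c i j d))
    (hI : ∀ c i j f d, I _ _ f → d < b j → P.comp f (v i) = P.comp (v j) (P.pipow o d) →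
      A c i j d = 0)
    (hiso : ∀ (c c' : ℚ) (φ : ∀ i, W i →ₗ[ℚ] W i), (∀ i, Function.Injective (φ i)) →
      (∀ i j d (g : P.Hom (X i) (X j)), d < b j →
        P.comp g (v i) = P.comp (v j) (P.pipow o d) → ∀ w,
          A c' i j d (φ i w) = φ j (A c i j d w)) → c = c') :
    ¬ RepFin P (Set.range X) I := by
  let T : ℚ → ∀ i j, P.Hom (X i) (X j) → (W i →ₗ[ℚ] W j) := fun c i j g =>
    if h : ∃ d < b j, P.comp g (v i) = P.comp (v j) (P.pipow o d) then A c i j h.choose else 0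
  have hT : ∀ c i j g d, d < b j → P.comp g (v i) = P.comp (v j) (P.pipow o d) →
      T c i j g = A c i j d := by
    intro c i j g d hd h
    have hex : ∃ d < b j, P.comp g (v i) = P.comp (v j) (P.pipow o d) := ⟨d, hd, h⟩
    change dite _ _ _ = _
    rw [dif_pos hex, comp_pipow_injective (hex.choose_spec.2.symm.trans h)
      (hne j _ hex.choose_spec.1)]
  have hT0 : ∀ c i j g, (¬ ∃ d < b j, P.comp g (v i) = P.comp (v j) (P.pipow o d)) →
      T c i j g = 0 := fun c i j g h => dif_neg h
  refine P.not_repFin_of_family I X hX W T ?_ ?_ ?_ ?_ ?_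
  · intro c i
    rw [hT c i i _ 0 (hb i) (by rw [P.id_comp, P.pipow_zero, P.comp_id]), hid]
  · intro c i j k g f
    by_cases hf : ∃ d < b j, P.comp f (v i) = P.comp (v j) (P.pipow o d)
    · obtain ⟨d, hd, hf⟩ := hf
      rw [hT c i j f d hd hf]
      by_cases hg : ∃ e < b k, P.comp g (v j) = P.comp (v k) (P.pipow o e)
      · obtain ⟨e, he, hg⟩ := hg
        rw [hT c j k g e he hg]
        have hgf : P.comp (P.comp g f) (v i) = P.comp (v k) (P.pipow o (e + d)) := by
          rw [P.assoc, hf, ← P.assoc, hg, P.assoc, ← pipow_add]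
        rw [← hlaw c i j k d e hd he (hallowed i j f d hd hf) (hallowed j k g e he hg)]
        by_cases hed : e + d < b k
        · exact hT c i k _ _ hed hgf
        · rw [hbig c i k _ (not_lt.1 hed)]
          refine hT0 c i k _ ?_
          rintro ⟨d', hd', h⟩
          rw [hgf] at h
          have := comp_pipow_injective h.symm (hne k d' hd')
          lia
      · rw [hT0 c j k g hg, LinearMap.zero_comp]
        refine hT0 c i k _ ?_
        rintro ⟨e, he, h⟩
        rw [P.assoc, hf, ← P.assoc] at h
        obtain ⟨e', h'⟩ := hright k _ d e he h
        refine hg ⟨e', ?_, h'⟩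
        rw [h', P.assoc, ← pipow_add] at h
        have := comp_pipow_injective h.symm (hne k e he)
        lia
    · rw [hT0 c i j f hf, LinearMap.comp_zero]
      refine hT0 c i k _ ?_
      rintro ⟨e, he, h⟩
      rw [P.assoc] at h
      exact hf (hleft j k _ g e he h)
  · intro c i j
    refine hT0 c i j _ ?_
    rintro ⟨d, hd, h⟩
    rw [P.zero_comp] at h
    exact hne j d hd h.symm
  · intro c i j f hf
    by_cases h : ∃ d < b j, P.comp f (v i) = P.comp (v j) (P.pipow o d)
    · obtain ⟨d, hd, h⟩ := h
      rw [hT c i j f d hd h]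
      exact hI c i j f d hf hd h
    · exact hT0 c i j f h
  · intro c c' φ hφ hn
    refine hiso c c' φ hφ fun i j d g hd h w => ?_
    have := hn i j g w
    rwa [hT c i j g d hd h, hT c' i j g d hd h] at this

end RayCategory

namespace RayCategory

/-- The points of a full subcategory with four objects. -/
inductive Four
  | o | z | w | y
  deriving DecidableEq

instance : Fintype Four := ⟨{.o, .z, .w, .y}, fun x => by cases x <;> simp⟩

/-- The combinatorial situation in which the four-point representations are constructed:
`v : o → z`, `b v : o → w` and `f : o → y`. -/
structure FourPoints (P : RayCategory) {o z w y : P.Obj} (v : P.Hom o z) (b : P.Hom z w)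
    (u : P.Hom w o) (f : P.Hom o y) : Prop where
  oz : o ≠ z
  ow : o ≠ w
  oy : o ≠ y
  zw : z ≠ w
  zy : z ≠ y
  wy : w ≠ y
  cube : P.pipow o 3 ≠ P.zero o o
  fourth : P.pipow o 4 = P.zero o o
  square : P.comp u (P.comp b v) = P.pipow o 2
  vr : P.comp v (P.pipow o 1) ≠ P.zero _ _
  bvr : P.comp (P.comp b v) (P.pipow o 1) ≠ P.zero _ _
  f_ne : f ≠ P.zero _ _
  hom_z : ∀ t : P.Hom o z, t = P.zero _ _ ∨ t = v ∨ t = P.comp v (P.pipow o 1)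
  hom_w : ∀ t : P.Hom o w, t = P.zero _ _ ∨ t = P.comp b v ∨
    t = P.comp (P.comp b v) (P.pipow o 1)
  left_o : ∀ (t : P.Hom o y) (h : P.Hom y o), P.comp h t ≠ P.zero _ _ → t = f
  left_z : ∀ (t : P.Hom o y) (h : P.Hom y z), P.comp h t ≠ P.zero _ _ → t = f
  left_w : ∀ (t : P.Hom o y) (h : P.Hom y w), P.comp h t ≠ P.zero _ _ → t = f
  left_y : ∀ (t : P.Hom o y) (h : P.Hom y y), P.comp h t = f → t = f
  right_y : ∀ (t : P.Hom o y) d, P.comp t (P.pipow o d) = f → t = f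
  label_zo : ∀ (g : P.Hom z o) d, d < 4 → P.comp g v = P.pipow o d → 2 ≤ d
  label_wo : ∀ (g : P.Hom w o) d, d < 4 → P.comp g (P.comp b v) = P.pipow o d → 2 ≤ d
  label_zz : ∀ g : P.Hom z z, P.comp g v ≠ P.comp v (P.pipow o 1)
  label_ww : ∀ g : P.Hom w w,
    P.comp g (P.comp b v) ≠ P.comp (P.comp b v) (P.pipow o 1)
  label_zw : ∀ g : P.Hom z w, P.comp g v ≠ P.comp (P.comp b v) (P.pipow o 1)
  label_wz : ∀ g : P.Hom w z, P.comp g (P.comp b v) = P.zero _ _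
  label_yo : ∀ (g : P.Hom y o) d, d < 3 → P.comp g f ≠ P.pipow o d
  label_yz : ∀ g : P.Hom y z, P.comp g f ≠ v
  label_yw : ∀ g : P.Hom y w, P.comp g f ≠ P.comp b v

/-- The linear data defining a representation of the full subcategory on four points.  The
propositions tell which of the morphisms `z → y`, `w → y`, `y → o`, `y → z`, `y → w` act. -/
structure FourRep (φz φw γo γz γw : Prop) (n : Four → ℕ) where
  R : (Fin (n .o) → ℚ) →ₗ[ℚ] (Fin (n .o) → ℚ)
  V : (Fin (n .o) → ℚ) →ₗ[ℚ] (Fin (n .z) → ℚ)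
  B : (Fin (n .z) → ℚ) →ₗ[ℚ] (Fin (n .w) → ℚ)
  U : (Fin (n .w) → ℚ) →ₗ[ℚ] (Fin (n .o) → ℚ)
  Fo : (Fin (n .o) → ℚ) →ₗ[ℚ] (Fin (n .y) → ℚ)
  Fz : (Fin (n .z) → ℚ) →ₗ[ℚ] (Fin (n .y) → ℚ)
  Fw : (Fin (n .w) → ℚ) →ₗ[ℚ] (Fin (n .y) → ℚ)
  Go : (Fin (n .y) → ℚ) →ₗ[ℚ] (Fin (n .o) → ℚ)
  Gz : (Fin (n .y) → ℚ) →ₗ[ℚ] (Fin (n .z) → ℚ)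
  Gw : (Fin (n .y) → ℚ) →ₗ[ℚ] (Fin (n .w) → ℚ)
  RRR : ∀ x, R (R (R x)) = 0
  UBV : ∀ x, U (B (V x)) = R (R x)
  RRU : ∀ x, R (R (U x)) = 0
  VU : ∀ x, V (U x) = 0
  VRU : ∀ x, V (R (U x)) = 0
  FoR : ∀ x, Fo (R x) = 0
  FoU : ∀ x, Fo (U x) = 0
  FzV : φz → ∀ x, Fz (V x) = Fo x
  FwB : φw → ∀ x, Fw (B x) = Fz x
  φwz : φw → φz
  γzw : γz → γw
  GzFo : γz → ∀ x, Gz (Fo x) = V (R x)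
  GwFo : γw → ∀ x, Gw (Fo x) = B (V (R x))
  GoFz : γo → φz → ∀ x, Go (Fz x) = R (U (B x))
  GoFw : γo → φw → ∀ x, Go (Fw x) = R (U x)
  UGw : γw → ∀ x, U (Gw x) = Go x
  BGz : ∀ x, B (Gz x) = Gw x
  GoFo : ∀ x, Go (Fo x) = 0
  GzFz : ∀ x, Gz (Fz x) = 0
  GwFz : ∀ x, Gw (Fz x) = 0
  GzFw : ∀ x, Gz (Fw x) = 0
  GwFw : ∀ x, Gw (Fw x) = 0
  RGo : ∀ x, R (Go x) = 0
  VGo : ∀ x, V (Go x) = 0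
  FoGo : ∀ x, Fo (Go x) = 0
  FzGz : ∀ x, Fz (Gz x) = 0
  FwGw : ∀ x, Fw (Gw x) = 0

namespace FourRep

variable {φz φw γo γz γw : Prop} {n : Four → ℕ}

/-- The action of a morphism of given label. -/
def act (F : FourRep φz φw γo γz γw n) :
    ∀ i j : Four, ℕ → ((Fin (n i) → ℚ) →ₗ[ℚ] (Fin (n j) → ℚ))
  | .o, .o, 0 => LinearMap.id
  | .o, .o, 1 => F.R
  | .o, .o, 2 => F.R.comp F.R
  | .o, .o, _ + 3 => 0
  | .o, .z, 0 => F.V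
  | .o, .z, 1 => F.V.comp F.R
  | .o, .z, _ + 2 => 0
  | .o, .w, 0 => F.B.comp F.V
  | .o, .w, 1 => F.B.comp (F.V.comp F.R)
  | .o, .w, _ + 2 => 0
  | .o, .y, 0 => F.Fo
  | .o, .y, _ + 1 => 0
  | .z, .o, 0 => 0
  | .z, .o, 1 => 0
  | .z, .o, 2 => F.U.comp F.B
  | .z, .o, 3 => F.R.comp (F.U.comp F.B)
  | .z, .o, _ + 4 => 0
  | .z, .z, 0 => LinearMap.id
  | .z, .z, _ + 1 => 0
  | .z, .w, 0 => F.B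
  | .z, .w, _ + 1 => 0
  | .z, .y, 0 => F.Fz
  | .z, .y, _ + 1 => 0
  | .w, .o, 0 => 0
  | .w, .o, 1 => 0
  | .w, .o, 2 => F.U
  | .w, .o, 3 => F.R.comp F.U
  | .w, .o, _ + 4 => 0
  | .w, .z, _ => 0
  | .w, .w, 0 => LinearMap.id
  | .w, .w, _ + 1 => 0
  | .w, .y, 0 => F.Fw
  | .w, .y, _ + 1 => 0
  | .y, .o, 0 => 0
  | .y, .o, 1 => 0
  | .y, .o, 2 => 0
  | .y, .o, 3 => F.Go
  | .y, .o, _ + 4 => 0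
  | .y, .z, 0 => 0
  | .y, .z, 1 => F.Gz
  | .y, .z, _ + 2 => 0
  | .y, .w, 0 => 0
  | .y, .w, 1 => F.Gw
  | .y, .w, _ + 2 => 0
  | .y, .y, 0 => LinearMap.id
  | .y, .y, _ + 1 => 0

end FourRep

/-- The nilpotency bounds of the labels. -/
def Four.bound : Four → ℕ
  | .o => 4
  | .z => 2
  | .w => 2
  | .y => 1

/-- The labels which can occur. -/
def Four.Allowed (φz φw γo γz γw : Prop) : Four → Four → ℕ → Prop
  | .o, _, _ => True
  | .z, .o, d => 2 ≤ d
  | .z, .z, d => d = 0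
  | .z, .w, d => d = 0
  | .z, .y, _ => φz
  | .w, .o, d => 2 ≤ d
  | .w, .z, _ => False
  | .w, .w, d => d = 0
  | .w, .y, _ => φw
  | .y, .o, d => d = 3 ∧ γo
  | .y, .z, d => d = 1 ∧ γz
  | .y, .w, d => d = 1 ∧ γw
  | .y, .y, _ => True

theorem FourRep.act_of_bound_le {φz φw γo γz γw : Prop} {n : Four → ℕ}
    (F : FourRep φz φw γo γz γw n) (i j : Four) (d : ℕ) (h : j.bound ≤ d) :
    F.act i j d = 0 := by
  obtain ⟨d, rfl⟩ := Nat.exists_eq_add_of_le' h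
  cases i <;> cases j <;> rfl

set_option maxHeartbeats 2000000 in
theorem FourRep.act_add {φz φw γo γz γw : Prop} {n : Four → ℕ}
    (F : FourRep φz φw γo γz γw n) (i j k : Four) (d e : ℕ) (hd : d < j.bound)
    (he : e < k.bound) (h : Four.Allowed φz φw γo γz γw i j d)
    (h' : Four.Allowed φz φw γo γz γw j k e) :
    F.act i k (e + d) = (F.act j k e).comp (F.act i j d) := by
  obtain ⟨R, V, B, U, Fo, Fz, Fw, Go, Gz, Gw, RRR, UBV, RRU, VU, VRU, FoR, FoU, FzV, FwB, φwz,
    γzw, GzFo, GwFo, GoFz, GoFw, UGw, BGz, GoFo, GzFz, GwFz, GzFw, GwFw, RGo, VGo, FoGo, FzGz,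
    FwGw⟩ := F
  have VRR : ∀ x, V (R (R x)) = 0 := fun x => by rw [← UBV, VU]
  refine LinearMap.ext fun x => ?_
  cases i <;> cases j <;> simp only [Four.Allowed] at h <;> cases k <;>
    simp only [Four.bound, Four.Allowed] at hd he h' <;>
    interval_cases d <;> interval_cases e <;>
    first
    | (exfalso; revert h; simp; done)
    | (exfalso; revert h'; simp; done)
    | simp [FourRep.act, *]

end RayCategory

namespace RayCategory

variable {P : RayCategory} {o z w y : P.Obj}

/-- The four objects as a family. -/
def fourObj (o z w y : P.Obj) : Four → P.Obj
  | .o => o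
  | .z => z
  | .w => w
  | .y => y

/-- The chosen morphisms from `o` to the four objects. -/
def fourHom (v : P.Hom o z) (v' : P.Hom o w) (f : P.Hom o y) :
    ∀ i : Four, P.Hom o (fourObj o z w y i)
  | .o => P.id o
  | .z => v
  | .w => v'
  | .y => f

namespace FourPoints

variable {v : P.Hom o z} {b : P.Hom z w} {u : P.Hom w o} {f : P.Hom o y}

theorem injective (H : FourPoints P v b u f) : Function.Injective (fourObj o z w y) := by
  intro i j h
  have := H.oz; have := H.ow; have := H.oy; have := H.zw; have := H.zy; have := H.wy
  cases i <;> cases j <;> simp_all [fourObj, eq_comm]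

theorem range_fourObj : Set.range (fourObj o z w y) = {o, z, w, y} := by
  ext t
  constructor
  · rintro ⟨i, rfl⟩
    cases i <;> simp [fourObj]
  · rintro (rfl | rfl | rfl | rfl)
    exacts [⟨.o, rfl⟩, ⟨.z, rfl⟩, ⟨.w, rfl⟩, ⟨.y, rfl⟩]

theorem ne_zero (H : FourPoints P v b u f) (j : Four) (d : ℕ) (hd : d < j.bound) :
    P.comp (fourHom v (P.comp b v) f j) (P.pipow o d) ≠ P.zero _ _ := by
  have h01 : ∀ d < 2, d = 0 ∨ d = 1 := by lia
  cases j
  · change P.comp (P.id o) _ ≠ _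
    rw [P.id_comp]
    exact fun h => H.cube (pipow_mono_zero (Nat.le_of_lt_succ hd) h)
  · rcases h01 d hd with rfl | rfl
    · rw [P.pipow_zero, P.comp_id]
      exact fun h => H.vr (by rw [show v = P.zero _ _ from h, P.zero_comp])
    · exact H.vr
  · rcases h01 d hd with rfl | rfl
    · rw [P.pipow_zero, P.comp_id]
      exact fun h => H.bvr (by rw [show P.comp b v = P.zero _ _ from h, P.zero_comp])
    · exact H.bvr
  · obtain rfl : d = 0 := by simpa [Four.bound] using hd
    rw [P.pipow_zero, P.comp_id]
    exact H.f_ne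

theorem exists_of_comp_eq (H : FourPoints P v b u f) (i k : Four)
    (t : P.Hom o (fourObj o z w y i)) (h : P.Hom (fourObj o z w y i) (fourObj o z w y k))
    (e : ℕ) (he : e < k.bound)
    (hh : P.comp h t = P.comp (fourHom v (P.comp b v) f k) (P.pipow o e)) :
    ∃ d < i.bound, t = P.comp (fourHom v (P.comp b v) f i) (P.pipow o d) := by
  have hn : P.comp h t ≠ P.zero _ _ := by rw [hh]; exact H.ne_zero k e he
  have ht : t ≠ P.zero _ _ := by
    rintro rfl
    exact hn (P.comp_zero _)
  cases i
  · obtain ⟨d, hd⟩ := P.endo_cyclic o t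
    refine ⟨d, ?_, by rw [hd]; exact (P.id_comp _).symm⟩
    by_contra hlt
    exact ht (hd.trans (pipow_mono_zero (not_lt.1 hlt) H.fourth))
  · rcases H.hom_z t with h | h | h
    · exact absurd h ht
    · exact ⟨0, by simp [Four.bound], by rw [P.pipow_zero, P.comp_id]; exact h⟩
    · exact ⟨1, by simp [Four.bound], h⟩
  · rcases H.hom_w t with h | h | h
    · exact absurd h ht
    · exact ⟨0, by simp [Four.bound], by rw [P.pipow_zero, P.comp_id]; exact h⟩
    · exact ⟨1, by simp [Four.bound], h⟩
  · refine ⟨0, by simp [Four.bound], ?_⟩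
    rw [P.pipow_zero, P.comp_id]
    cases k
    · exact H.left_o t h hn
    · exact H.left_z t h hn
    · exact H.left_w t h hn
    · obtain rfl : e = 0 := by simpa [Four.bound] using he
      rw [P.pipow_zero, P.comp_id] at hh
      exact H.left_y t h hh

theorem exists_of_comp_pipow_eq (H : FourPoints P v b u f) (j : Four)
    (t : P.Hom o (fourObj o z w y j)) (d e : ℕ) (he : e < j.bound)
    (hh : P.comp t (P.pipow o d) = P.comp (fourHom v (P.comp b v) f j) (P.pipow o e)) :
    ∃ d', t = P.comp (fourHom v (P.comp b v) f j) (P.pipow o d') := by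
  have ht : t ≠ P.zero _ _ := by
    rintro rfl
    rw [P.zero_comp] at hh
    exact H.ne_zero j e he hh.symm
  cases j
  · obtain ⟨d, hd⟩ := P.endo_cyclic o t
    exact ⟨d, by rw [hd]; exact (P.id_comp _).symm⟩
  · rcases H.hom_z t with h | h | h
    · exact absurd h ht
    · exact ⟨0, by rw [P.pipow_zero, P.comp_id]; exact h⟩
    · exact ⟨1, h⟩
  · rcases H.hom_w t with h | h | h
    · exact absurd h ht
    · exact ⟨0, by rw [P.pipow_zero, P.comp_id]; exact h⟩
    · exact ⟨1, h⟩
  · obtain rfl : e = 0 := by simpa [Four.bound] using he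
    rw [P.pipow_zero, P.comp_id] at hh
    exact ⟨0, by rw [P.pipow_zero, P.comp_id]; exact H.right_y t d hh⟩

theorem allowed (H : FourPoints P v b u f) {φz φw γo γz γw : Prop}
    (hφz : (∃ k : P.Hom z y, P.comp k v = f) → φz)
    (hφw : (∃ k : P.Hom w y, P.comp k (P.comp b v) = f) → φw)
    (hγo : (∃ g : P.Hom y o, P.comp g f = P.pipow o 3) → γo)
    (hγz : (∃ g : P.Hom y z, P.comp g f = P.comp v (P.pipow o 1)) → γz)
    (hγw : (∃ g : P.Hom y w, P.comp g f = P.comp (P.comp b v) (P.pipow o 1)) → γw)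
    (i j : Four) (g : P.Hom (fourObj o z w y i) (fourObj o z w y j)) (d : ℕ)
    (hd : d < j.bound)
    (hh : P.comp g (fourHom v (P.comp b v) f i) =
      P.comp (fourHom v (P.comp b v) f j) (P.pipow o d)) :
    Four.Allowed φz φw γo γz γw i j d := by
  have h01 : ∀ d < 2, d = 0 ∨ d = 1 := by lia
  have h0 : ∀ d < 1, d = 0 := by lia
  cases i <;> cases j <;> simp only [Four.Allowed]
  · exact H.label_zo g d hd (hh.trans (P.id_comp _))
  · rcases h01 d hd with rfl | rfl
    · rfl
    · exact absurd hh (H.label_zz g)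
  · rcases h01 d hd with rfl | rfl
    · rfl
    · exact absurd hh (H.label_zw g)
  · obtain rfl := h0 d hd
    rw [P.pipow_zero, P.comp_id] at hh
    exact hφz ⟨g, hh⟩
  · exact H.label_wo g d hd (hh.trans (P.id_comp _))
  · exact H.ne_zero .z d hd (hh.symm.trans (H.label_wz g))
  · rcases h01 d hd with rfl | rfl
    · rfl
    · exact absurd hh (H.label_ww g)
  · obtain rfl := h0 d hd
    rw [P.pipow_zero, P.comp_id] at hh
    exact hφw ⟨g, hh⟩
  · have hh' : P.comp g f = P.pipow o d := hh.trans (P.id_comp _)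
    by_cases h3 : d < 3
    · exact absurd hh' (H.label_yo g d h3)
    · obtain rfl : d = 3 := by simp only [Four.bound] at hd; lia
      exact ⟨rfl, hγo ⟨g, hh'⟩⟩
  · rcases h01 d hd with rfl | rfl
    · rw [P.pipow_zero, P.comp_id] at hh
      exact absurd hh (H.label_yz g)
    · exact ⟨rfl, hγz ⟨g, hh⟩⟩
  · rcases h01 d hd with rfl | rfl
    · rw [P.pipow_zero, P.comp_id] at hh
      exact absurd hh (H.label_yw g)
    · exact ⟨rfl, hγw ⟨g, hh⟩⟩

/-- A one-parameter family of pairwise non-isomorphic representations of the same dimension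
on four points rules out representation-finiteness. -/
theorem not_repFin (H : FourPoints P v b u f) {φz φw γo γz γw : Prop}
    (hφz : (∃ k : P.Hom z y, P.comp k v = f) ↔ φz)
    (hφw : (∃ k : P.Hom w y, P.comp k (P.comp b v) = f) ↔ φw)
    (hγo : (∃ g : P.Hom y o, P.comp g f = P.pipow o 3) ↔ γo)
    (hγz : (∃ g : P.Hom y z, P.comp g f = P.comp v (P.pipow o 1)) ↔ γz)
    (hγw : (∃ g : P.Hom y w, P.comp g f = P.comp (P.comp b v) (P.pipow o 1)) ↔ γw)
    (n : Four → ℕ) (F : ℚ → FourRep φz φw γo γz γw n)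
    (hiso : ∀ (c c' : ℚ) (o : (Fin (n .o) → ℚ) →ₗ[ℚ] Fin (n .o) → ℚ)
      (z : (Fin (n .z) → ℚ) →ₗ[ℚ] Fin (n .z) → ℚ)
      (w : (Fin (n .w) → ℚ) →ₗ[ℚ] Fin (n .w) → ℚ)
      (y : (Fin (n .y) → ℚ) →ₗ[ℚ] Fin (n .y) → ℚ),
      Function.Injective o → Function.Injective y →
      (∀ t, (F c').R (o t) = o ((F c).R t)) → (∀ t, (F c').V (o t) = z ((F c).V t)) →
      (∀ t, (F c').B (z t) = w ((F c).B t)) → (∀ t, (F c').U (w t) = o ((F c).U t)) →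
      (∀ t, (F c').Fo (o t) = y ((F c).Fo t)) →
      (φz → ∀ t, (F c').Fz (z t) = y ((F c).Fz t)) →
      (φw → ∀ t, (F c').Fw (w t) = y ((F c).Fw t)) →
      (γo → ∀ t, (F c').Go (y t) = o ((F c).Go t)) →
      (γz → ∀ t, (F c').Gz (y t) = z ((F c).Gz t)) →
      (γw → ∀ t, (F c').Gw (y t) = w ((F c).Gw t)) → c = c') :
    ¬ RepFin P {o, z, w, y} (IdealOf P (P.pipow o 3)) := by
  rw [← range_fourObj]
  refine not_repFin_of_labels _ (fourObj o z w y) H.injective o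
    (fourHom v (P.comp b v) f) Four.bound (fun i => by cases i <;> simp [Four.bound])
    H.ne_zero H.exists_of_comp_eq H.exists_of_comp_pipow_eq (fun i => Fin (n i) → ℚ)
    (fun c i j d => (F c).act i j d) (Four.Allowed φz φw γo γz γw)
    (H.allowed hφz.1 hφw.1 hγo.1 hγz.1 hγw.1) ?_ (fun c => (F c).act_of_bound_le)
    (fun c => (F c).act_add) ?_ ?_
  · intro c i
    cases i <;> rfl
  · rintro c i j g d ⟨g', h, rfl⟩ hd hh
    obtain ⟨m, hm⟩ := P.endo_cyclic o (P.comp h (fourHom v (P.comp b v) f i))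
    have e1 : P.comp (P.comp g' (P.pipow o m)) (P.pipow o 3) =
        P.comp (fourHom v (P.comp b v) f j) (P.pipow o d) := by
      rw [← hh, P.assoc, P.assoc, P.assoc, hm, ← pipow_add, ← pipow_add, add_comm]
    obtain ⟨d', hd'⟩ := H.exists_of_comp_pipow_eq j _ 3 d hd e1
    rw [hd', P.assoc, ← pipow_add] at e1
    have e2 := comp_pipow_injective e1.symm (H.ne_zero j d hd)
    cases j
    case z => simp only [Four.bound] at hd; lia
    case w => simp only [Four.bound] at hd; lia
    case y => simp only [Four.bound] at hd; lia
    obtain rfl : d' = 0 := by simp only [Four.bound] at hd; lia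
    have e3 : P.comp (P.comp g' h) (fourHom v (P.comp b v) f i) = P.id o := by
      rw [P.assoc, hm, hd', P.pipow_zero, P.comp_id]
      rfl
    obtain rfl : i = .o := H.injective (eq_of_comp_eq_id e3).symm
    subst e2
    rfl
  · intro c c' φ hφ hn
    have h0 : ∀ {a : P.Obj} (t : P.Hom o a), t = P.comp t (P.pipow o 0) := fun t => by
      rw [P.pipow_zero, P.comp_id]
    refine hiso c c' (φ .o) (φ .z) (φ .w) (φ .y) (hφ _) (hφ _)
      (fun t => hn .o .o 1 (P.pipow o 1) (by simp [Four.bound]) ?_ t)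
      (fun t => hn .o .z 0 v (by simp [Four.bound]) ?_ t)
      (fun t => hn .z .w 0 b (by simp [Four.bound]) (h0 _) t)
      (fun t => hn .w .o 2 u (by simp [Four.bound]) (H.square.trans (P.id_comp _).symm) t)
      (fun t => hn .o .y 0 f (by simp [Four.bound]) ?_ t)
      (fun h t => ?_) (fun h t => ?_) (fun h t => ?_) (fun h t => ?_) (fun h t => ?_)
    · exact (P.comp_id _).trans (P.id_comp _).symm
    · exact (P.comp_id _).trans (h0 _)
    · exact (P.comp_id _).trans (h0 _)
    · obtain ⟨k, hk⟩ := hφz.2 h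
      exact hn .z .y 0 k (by simp [Four.bound]) (hk.trans (h0 _)) t
    · obtain ⟨k, hk⟩ := hφw.2 h
      exact hn .w .y 0 k (by simp [Four.bound]) (hk.trans (h0 _)) t
    · obtain ⟨k, hk⟩ := hγo.2 h
      exact hn .y .o 3 k (by simp [Four.bound]) (hk.trans (P.id_comp _).symm) t
    · obtain ⟨k, hk⟩ := hγz.2 h
      exact hn .y .z 1 k (by simp [Four.bound]) hk t
    · obtain ⟨k, hk⟩ := hγw.2 h
      exact hn .y .w 1 k (by simp [Four.bound]) hk t

end FourPoints

end RayCategory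

namespace RayCategory

/-- The dimension function of a four-point representation. -/
abbrev fourDim (o z w y : ℕ) : Four → ℕ
  | .o => o
  | .z => z
  | .w => w
  | .y => y

/-- Coordinate functionals. -/
abbrev coord {n : ℕ} (i : Fin n) : (Fin n → ℚ) →ₗ[ℚ] ℚ := LinearMap.proj i

/-- The linear map with the given coordinate functionals. -/
abbrev ofRows {m n : ℕ} (r : Fin m → ((Fin n → ℚ) →ₗ[ℚ] ℚ)) : (Fin n → ℚ) →ₗ[ℚ] (Fin m → ℚ) :=
  LinearMap.pi r

/-- The family used when `f` factors through both `z` and `w`. -/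
def familyZW (c : ℚ) : FourRep True True False False False (fourDim 4 2 3 1) where
  R := ofRows (m := 4) (n := 4) ![0, coord 0, coord 0, (1 - c) • coord 1 + c • coord 2]
  V := ofRows (m := 2) (n := 4) ![0, coord 0]
  B := ofRows (m := 3) (n := 2) ![coord 0, 0, coord 1]
  U := ofRows (m := 4) (n := 3) ![0, coord 0, coord 1, coord 2]
  Fo := 0
  Fz := ofRows (m := 1) (n := 2) ![coord 0]
  Fw := ofRows (m := 1) (n := 3) ![coord 0]
  Go := 0
  Gz := 0
  Gw := 0
  RRR x := by ext i; fin_cases i <;> simp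
  UBV x := by ext i; fin_cases i <;> simp; ring
  RRU x := by ext i; fin_cases i <;> simp
  VU x := by ext i; fin_cases i <;> simp
  VRU x := by ext i; fin_cases i <;> simp
  FoR x := rfl
  FoU x := rfl
  FzV _ x := by ext i; fin_cases i; simp
  FwB _ x := by ext i; fin_cases i; simp
  φwz := fun h => h
  γzw := fun h => h
  GzFo h := h.elim
  GwFo h := h.elim
  GoFz h := h.elim
  GoFw h := h.elim
  UGw h := h.elim
  BGz x := map_zero _
  GoFo x := rfl
  GzFz x := rfl
  GwFz x := rfl
  GzFw x := rfl
  GwFw x := rfl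
  RGo x := map_zero _
  VGo x := map_zero _
  FoGo x := map_zero _
  FzGz x := map_zero _
  FwGw x := map_zero _

theorem familyZW_inj (c c' : ℚ) (o : (Fin 4 → ℚ) →ₗ[ℚ] Fin 4 → ℚ)
    (z : (Fin 2 → ℚ) →ₗ[ℚ] Fin 2 → ℚ) (w : (Fin 3 → ℚ) →ₗ[ℚ] Fin 3 → ℚ)
    (y : (Fin 1 → ℚ) →ₗ[ℚ] Fin 1 → ℚ) (ho : Function.Injective o)
    (hR : ∀ t, (familyZW c').R (o t) = o ((familyZW c).R t))
    (hB : ∀ t, (familyZW c').B (z t) = w ((familyZW c).B t))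
    (hU : ∀ t, (familyZW c').U (w t) = o ((familyZW c).U t))
    (hF : ∀ t, (familyZW c').Fw (w t) = y ((familyZW c).Fw t)) : c = c' := by
  have eB : (familyZW c).B ![1, 0] = ![1, 0, 0] := by
    ext i; fin_cases i <;> simp [familyZW]
  have eF : (familyZW c).Fw ![0, 1, 0] = 0 := by ext i; fin_cases i; simp [familyZW]
  have eR : (familyZW c).R ![1, 0, 0, 0] = (familyZW c).U (![1, 0, 0] + ![0, 1, 0]) := by
    ext i; fin_cases i <;> simp [familyZW]
  have eRU : (familyZW c).R ((familyZW c).U (c • ![1, 0, 0] + (c - 1) • ![0, 1, 0])) = 0 := by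
    ext i; fin_cases i <;> simp [familyZW]; ring
  have eRR : (familyZW c).R ((familyZW c).R ![1, 0, 0, 0]) = ![0, 0, 0, 1] := by
    ext i; fin_cases i <;> simp [familyZW]
  have h1 := hB ![1, 0]
  rw [eB] at h1
  have h2 := hF ![0, 1, 0]
  rw [eF, map_zero] at h2
  have h3 := hR ![1, 0, 0, 0]
  rw [eR, ← hU, map_add, ← h1] at h3
  have h4 := congrArg o eRU
  rw [← hR, ← hU, map_add, map_smul, map_smul, ← h1, map_zero] at h4
  have h5 := congrArg o eRR
  rw [← hR, ← hR] at h5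
  have k2 := congrFun h2 0
  have k31 := congrFun h3 1
  have k32 := congrFun h3 2
  have k4 := congrFun h4 3
  have hd : o ![1, 0, 0, 0] 0 ≠ 0 := by
    intro hd
    have : ![0, 0, 0, 1] = (0 : Fin 4 → ℚ) := ho <| by
      rw [← h5, map_zero]
      ext i; fin_cases i <;> simp [familyZW, hd]
    simpa using congrFun this 3
  simp [familyZW] at k2 k31 k32 k4
  apply mul_right_cancel₀ hd
  linear_combination k4 + (1 - c') * c * k31 + c' * (c - 1) * k32 + (1 - c') * k2

/-- The family used when `π(o) ^ 3` factors through `f`, which factors through `w`. -/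
def familyO (c : ℚ) : FourRep True True True False False (fourDim 3 1 2 2) where
  R := ofRows (m := 3) (n := 3) ![0, coord 0, coord 0]
  V := 0
  B := ofRows (m := 2) (n := 1) ![coord 0, 0]
  U := ofRows (m := 3) (n := 2) ![0, coord 0, coord 1]
  Fo := 0
  Fz := ofRows (m := 2) (n := 1) ![0, coord 0]
  Fw := ofRows (m := 2) (n := 2) ![0, coord 0]
  Go := ofRows (m := 3) (n := 2) ![0, coord 0, c • coord 0]
  Gz := 0
  Gw := 0
  RRR x := by ext i; fin_cases i <;> simp
  UBV x := by ext i; fin_cases i <;> simp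
  RRU x := by ext i; fin_cases i <;> simp
  VU x := by ext i; fin_cases i; simp
  VRU x := by ext i; fin_cases i; simp
  FoR x := by ext i; fin_cases i <;> simp
  FoU x := by ext i; fin_cases i <;> simp
  FzV _ x := by ext i; fin_cases i <;> simp
  FwB _ x := by ext i; fin_cases i <;> simp
  φwz := fun h => h
  γzw := fun h => h
  GzFo h := h.elim
  GwFo h := h.elim
  GoFz _ _ x := by ext i; fin_cases i <;> simp
  GoFw _ _ x := by ext i; fin_cases i <;> simp
  UGw h := h.elim
  BGz x := by ext i; fin_cases i <;> simp
  GoFo x := by ext i; fin_cases i <;> simp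
  GzFz x := by ext i; fin_cases i; simp
  GwFz x := by ext i; fin_cases i <;> simp
  GzFw x := by ext i; fin_cases i; simp
  GwFw x := by ext i; fin_cases i <;> simp
  RGo x := by ext i; fin_cases i <;> simp
  VGo x := by ext i; fin_cases i; simp
  FoGo x := by ext i; fin_cases i <;> simp
  FzGz x := by ext i; fin_cases i <;> simp
  FwGw x := by ext i; fin_cases i <;> simp

theorem familyO_inj (c c' : ℚ) (o : (Fin 3 → ℚ) →ₗ[ℚ] Fin 3 → ℚ)
    (z : (Fin 1 → ℚ) →ₗ[ℚ] Fin 1 → ℚ) (w : (Fin 2 → ℚ) →ₗ[ℚ] Fin 2 → ℚ)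
    (y : (Fin 2 → ℚ) →ₗ[ℚ] Fin 2 → ℚ) (ho : Function.Injective o)
    (hR : ∀ t, (familyO c').R (o t) = o ((familyO c).R t))
    (hB : ∀ t, (familyO c').B (z t) = w ((familyO c).B t))
    (hU : ∀ t, (familyO c').U (w t) = o ((familyO c).U t))
    (hFw : ∀ t, (familyO c').Fw (w t) = y ((familyO c).Fw t))
    (hGo : ∀ t, (familyO c').Go (y t) = o ((familyO c).Go t)) : c = c' := by
  have eB : (familyO c).B ![1] = ![1, 0] := by
    ext i; fin_cases i <;> simp [familyO]
  have eF : (familyO c).Fw ![0, 1] = 0 := by ext i; fin_cases i <;> simp [familyO]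
  have eR : (familyO c).R ![1, 0, 0] = (familyO c).U (![1, 0] + ![0, 1]) := by
    ext i; fin_cases i <;> simp [familyO]
  have eR' : (familyO c).R ![1, 0, 0] = ![0, 1, 1] := by
    ext i; fin_cases i <;> simp [familyO]
  have eG : (familyO c).Go ![1, 0] = (familyO c).U (![1, 0] + c • ![0, 1]) := by
    ext i; fin_cases i <;> simp [familyO]
  have h1 := hB ![1]
  rw [eB] at h1
  have h2 := hFw ![0, 1]
  rw [eF, map_zero] at h2
  have h3 := hR ![1, 0, 0]
  have h4 := h3
  rw [eR, ← hU, map_add, ← h1] at h3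
  rw [eR'] at h4
  have h5 := hGo ![1, 0]
  rw [eG, ← hU, map_add, map_smul, ← h1] at h5
  have k2 := congrFun h2 1
  have k31 := congrFun h3 1
  have k32 := congrFun h3 2
  have k51 := congrFun h5 1
  have k52 := congrFun h5 2
  have hd : o ![1, 0, 0] 0 ≠ 0 := by
    intro hd
    have : ![0, 1, 1] = (0 : Fin 3 → ℚ) := ho <| by
      rw [← h4, map_zero]
      ext i; fin_cases i <;> simp [familyO, hd]
    simpa using congrFun this 1
  simp [familyO] at k2 k31 k32 k51 k52
  apply mul_right_cancel₀ hd
  linear_combination c * k32 - k52 + c' * k51 - c' * k31 + (c * c' - c') * k2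

/-- The family used when `v π(o)` factors through `f`, which factors through neither `z` nor `w`. -/
def familyGamma (c : ℚ) : FourRep False False True True True (fourDim 3 2 1 2) where
  R := ofRows (m := 3) (n := 3) ![0, 0, coord 0]
  V := ofRows (m := 2) (n := 3) ![coord 0, coord 1]
  B := ofRows (m := 1) (n := 2) ![coord 1]
  U := 0
  Fo := ofRows (m := 2) (n := 3) ![0, coord 0 - coord 1]
  Fz := 0
  Fw := 0
  Go := 0
  Gz := ofRows (m := 2) (n := 2) ![coord 0, c • coord 0]
  Gw := ofRows (m := 1) (n := 2) ![c • coord 0]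
  RRR x := by ext i; fin_cases i <;> simp
  UBV x := by ext i; fin_cases i <;> simp
  RRU x := by ext i; fin_cases i <;> simp
  VU x := by ext i; fin_cases i <;> simp
  VRU x := by ext i; fin_cases i <;> simp
  FoR x := by ext i; fin_cases i <;> simp
  FoU x := by ext i; fin_cases i <;> simp
  FzV h := h.elim
  FwB h := h.elim
  φwz := fun h => h
  γzw := fun h => h
  GzFo _ x := by ext i; fin_cases i <;> simp
  GwFo _ x := by ext i; fin_cases i; simp
  GoFz _ h := h.elim
  GoFw _ h := h.elim
  UGw _ x := by ext i; fin_cases i <;> simp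
  BGz x := by ext i; fin_cases i; simp
  GoFo x := by ext i; fin_cases i <;> simp
  GzFz x := by ext i; fin_cases i <;> simp
  GwFz x := by ext i; fin_cases i; simp
  GzFw x := by ext i; fin_cases i <;> simp
  GwFw x := by ext i; fin_cases i; simp
  RGo x := by ext i; fin_cases i <;> simp
  VGo x := by ext i; fin_cases i <;> simp
  FoGo x := by ext i; fin_cases i <;> simp
  FzGz x := by ext i; fin_cases i <;> simp
  FwGw x := by ext i; fin_cases i <;> simp

theorem familyGamma_inj (c c' : ℚ) (o : (Fin 3 → ℚ) →ₗ[ℚ] Fin 3 → ℚ)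
    (z : (Fin 2 → ℚ) →ₗ[ℚ] Fin 2 → ℚ) (w : (Fin 1 → ℚ) →ₗ[ℚ] Fin 1 → ℚ)
    (y : (Fin 2 → ℚ) →ₗ[ℚ] Fin 2 → ℚ) (ho : Function.Injective o)
    (hR : ∀ t, (familyGamma c').R (o t) = o ((familyGamma c).R t))
    (hV : ∀ t, (familyGamma c').V (o t) = z ((familyGamma c).V t))
    (hB : ∀ t, (familyGamma c').B (z t) = w ((familyGamma c).B t))
    (hFo : ∀ t, (familyGamma c').Fo (o t) = y ((familyGamma c).Fo t))
    (hGz : ∀ t, (familyGamma c').Gz (y t) = z ((familyGamma c).Gz t)) : c = c' := by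
  have e2 : (familyGamma c).R ![0, 1, 0] = 0 := by
    ext i; fin_cases i <;> simp [familyGamma]
  have e1 : (familyGamma c).B ((familyGamma c).V ![1, 0, 0]) = 0 := by
    ext i; fin_cases i; simp [familyGamma]
  have eR : (familyGamma c).R ![1, 0, 0] = ![0, 0, 1] := by
    ext i; fin_cases i <;> simp [familyGamma]
  have eF : (familyGamma c).Fo (![1, 0, 0] + ![0, 1, 0]) = 0 := by
    ext i; fin_cases i <;> simp [familyGamma]
  have eG : (familyGamma c).Gz ![1, 0] = (familyGamma c).V (![1, 0, 0] + c • ![0, 1, 0]) := by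
    ext i; fin_cases i <;> simp [familyGamma]
  have h1 := hR ![0, 1, 0]
  rw [e2, map_zero] at h1
  have h2 := hB ((familyGamma c).V ![1, 0, 0])
  rw [e1, map_zero, ← hV] at h2
  have h3 := hR ![1, 0, 0]
  rw [eR] at h3
  have h4 := hFo (![1, 0, 0] + ![0, 1, 0])
  rw [eF, map_zero, map_add] at h4
  have h5 := hGz ![1, 0]
  rw [eG, ← hV, map_add, map_smul] at h5
  have k1 := congrFun h1 2
  have k2 := congrFun h2 0
  have k4 := congrFun h4 1
  have k51 := congrFun h5 0
  have k52 := congrFun h5 1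
  have hd : o ![1, 0, 0] 0 ≠ 0 := by
    intro hd
    have : ![0, 0, 1] = (0 : Fin 3 → ℚ) := ho <| by
      rw [← h3, map_zero]
      ext i; fin_cases i <;> simp [familyGamma, hd]
    simpa using congrFun this 2
  simp [familyGamma] at k1 k2 k4 k51 k52
  rw [k1] at k4 k51
  rw [k2] at k4 k52
  apply mul_right_cancel₀ hd
  linear_combination c * k4 - k52 + c' * k51

/-- The family used when `f` factors through `z` but not through `w`. -/
def familyZ (c : ℚ) : FourRep True False False False False (fourDim 9 6 5 2) where
  R := ofRows (m := 9) (n := 9) ![0, 0, 0, coord 0, coord 1, coord 2, 0, coord 3, coord 4 - coord 6]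
  V := ofRows (m := 6) (n := 9) ![0, coord 0, coord 1, coord 2, 0, coord 5]
  B := ofRows (m := 5) (n := 6) ![coord 0, 0, coord 1, coord 2, coord 3]
  U := ofRows (m := 9) (n := 5) ![0, 0, 0, coord 1, 0, 0, coord 0, coord 2, coord 3]
  Fo := ofRows (m := 2) (n := 9) ![(c - 1) • coord 0 - c • coord 1 + coord 2, coord 0 - coord 1]
  Fz := ofRows (m := 2) (n := 6) ![(c - 1) • coord 1 - c • coord 2 + coord 3, coord 4 + coord 1 - coord 2]
  Fw := 0
  Go := 0
  Gz := 0
  Gw := 0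
  RRR x := by ext i; fin_cases i <;> simp
  UBV x := by ext i; fin_cases i <;> simp
  RRU x := by ext i; fin_cases i <;> simp
  VU x := by ext i; fin_cases i <;> simp
  VRU x := by ext i; fin_cases i <;> simp
  FoR x := by ext i; fin_cases i <;> simp
  FoU x := by ext i; fin_cases i <;> simp
  FzV _ x := by ext i; fin_cases i <;> simp
  FwB h := h.elim
  φwz := False.elim
  γzw := fun h => h
  GzFo h := h.elim
  GwFo h := h.elim
  GoFz h := h.elim
  GoFw h := h.elim
  UGw h := h.elim
  BGz x := by ext i; fin_cases i <;> simp
  GoFo x := by ext i; fin_cases i <;> simp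
  GzFz x := by ext i; fin_cases i <;> simp
  GwFz x := by ext i; fin_cases i <;> simp
  GzFw x := by ext i; fin_cases i <;> simp
  GwFw x := by ext i; fin_cases i <;> simp
  RGo x := by ext i; fin_cases i <;> simp
  VGo x := by ext i; fin_cases i <;> simp
  FoGo x := by ext i; fin_cases i <;> simp
  FzGz x := by ext i; fin_cases i <;> simp
  FwGw x := by ext i; fin_cases i <;> simp

theorem familyZ_inj (c c' : ℚ) (o : (Fin 9 → ℚ) →ₗ[ℚ] Fin 9 → ℚ)
    (z : (Fin 6 → ℚ) →ₗ[ℚ] Fin 6 → ℚ) (w : (Fin 5 → ℚ) →ₗ[ℚ] Fin 5 → ℚ)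
    (y : (Fin 2 → ℚ) →ₗ[ℚ] Fin 2 → ℚ) (ho : Function.Injective o)
    (hR : ∀ t, (familyZ c').R (o t) = o ((familyZ c).R t))
    (hV : ∀ t, (familyZ c').V (o t) = z ((familyZ c).V t))
    (hB : ∀ t, (familyZ c').B (z t) = w ((familyZ c).B t))
    (hU : ∀ t, (familyZ c').U (w t) = o ((familyZ c).U t))
    (hFz : ∀ t, (familyZ c').Fz (z t) = y ((familyZ c).Fz t)) : c = c' := by
  have eσ : (familyZ c).B ![0, 0, 0, 0, 1, 0] = 0 := by
    ext i; fin_cases i <;> simp [familyZ]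
  have eτ : (familyZ c).U ((familyZ c).B ![1, 0, 0, 0, 0, 0]) = ![0, 0, 0, 0, 0, 0, 1, 0, 0] := by
    ext i; fin_cases i <;> simp [familyZ]
  have e1 : (familyZ c).R ![1, 0, 0, 0, 0, 0, 0, 0, 0] = (familyZ c).U ![0, 1, 0, 0, 0] := by
    ext i; fin_cases i <;> simp [familyZ]
  have e2 : (familyZ c).V ((familyZ c).R ![0, 1, 0, 0, 0, 0, 0, 0, 0]) = 0 := by
    ext i; fin_cases i <;> simp [familyZ]
  have e3 : (familyZ c).R ((familyZ c).R ![0, 0, 1, 0, 0, 0, 0, 0, 0]) = 0 := by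
    ext i; fin_cases i <;> simp [familyZ]
  have e4 : (familyZ c).R ((familyZ c).R ![0, 1, 0, 0, 0, 0, 0, 0, 0] +
      ![0, 0, 0, 0, 0, 0, 1, 0, 0]) = 0 := by
    ext i; fin_cases i <;> simp [familyZ, Matrix.vecHead, Matrix.vecTail]
  have e5 : (familyZ c).Fz ((familyZ c).V (![1, 0, 0, 0, 0, 0, 0, 0, 0] + ![0, 1, 0, 0, 0, 0, 0, 0, 0] +
      ![0, 0, 1, 0, 0, 0, 0, 0, 0])) = 0 := by
    ext i; fin_cases i <;> simp [familyZ]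
  have e6 : (familyZ c).Fz ((familyZ c).V (![0, 1, 0, 0, 0, 0, 0, 0, 0] +
      c • ![0, 0, 1, 0, 0, 0, 0, 0, 0]) + ![0, 0, 0, 0, 1, 0]) = 0 := by
    ext i; fin_cases i <;> simp [familyZ, Matrix.vecHead, Matrix.vecTail]
  have e7 : (familyZ c).R ((familyZ c).R ![1, 0, 0, 0, 0, 0, 0, 0, 0]) = ![0, 0, 0, 0, 0, 0, 0, 1, 0] := by
    ext i; fin_cases i <;> simp [familyZ]
  have hσ := hB ![0, 0, 0, 0, 1, 0]
  rw [eσ, map_zero] at hσ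
  have hτ := congrArg o eτ
  rw [← hU, ← hB] at hτ
  have h1 := congrArg o e1
  rw [← hR, ← hU] at h1
  have h2 := congrArg z e2
  rw [← hV, ← hR, map_zero] at h2
  have h3 := congrArg o e3
  rw [← hR, ← hR, map_zero] at h3
  have h4 := congrArg o e4
  rw [← hR, map_add, ← hR, ← hτ, map_zero] at h4
  have h5 := congrArg y e5
  rw [← hFz, ← hV, map_add o, map_add o, map_zero] at h5
  have h6 := congrArg y e6
  rw [← hFz, map_add z, ← hV, map_add o, map_smul, map_zero] at h6
  have h7 := congrArg o e7
  rw [← hR, ← hR] at h7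
  have kσ1 := congrFun hσ 2
  have kσ2 := congrFun hσ 3
  have kσ3 := congrFun hσ 4
  have k11 := congrFun h1 4
  have k12 := congrFun h1 5
  have k2 := congrFun h2 5
  have k31 := congrFun h3 7
  have k32 := congrFun h3 8
  have k4 := congrFun h4 7
  have k51 := congrFun h5 0
  have k52 := congrFun h5 1
  have k6 := congrFun h6 0
  simp [familyZ] at kσ1 kσ2 kσ3 k11 k12 k2 k31 k32 k4 k51 k52 k6
  have hd : o ![1, 0, 0, 0, 0, 0, 0, 0, 0] 0 ≠ 0 := by
    intro hd
    have : ![0, 0, 0, 0, 0, 0, 0, 1, 0] = (0 : Fin 9 → ℚ) := ho <| by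
      rw [← h7, map_zero]
      ext i; fin_cases i <;> simp [familyZ, hd, k11]
    simpa using congrFun this 7
  rw [kσ1, kσ2, kσ3, k2, k4, k31, k32] at k6
  rw [k11, k12, k2, k4, k31, k32] at k51
  rw [k11, k4, k31, k32] at k52
  apply mul_right_cancel₀ hd
  linear_combination k6 - c * k51 + (c * c' - c') * k52

/-- The family used when `f` factors neither through `z` nor through `w`. -/
def familyNone (c : ℚ) : FourRep False False False False False (fourDim 9 5 4 2) where
  R := ofRows (m := 9) (n := 9) ![0, 0, 0, 0, coord 0, coord 1, coord 2, coord 3, coord 7]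
  V := ofRows (m := 5) (n := 9) ![0, coord 1, coord 2, coord 3, coord 4]
  B := ofRows (m := 4) (n := 5) ![0, coord 0, coord 2, coord 3]
  U := ofRows (m := 9) (n := 4) ![0, 0, 0, 0, 0, 0, coord 0, coord 1, coord 3]
  Fo := ofRows (m := 2) (n := 9) ![coord 2 - coord 0 - coord 1, coord 3 - coord 0 - c • coord 1]
  Fz := 0
  Fw := 0
  Go := 0
  Gz := 0
  Gw := 0
  RRR x := by ext i; fin_cases i <;> simp
  UBV x := by ext i; fin_cases i <;> simp
  RRU x := by ext i; fin_cases i <;> simp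
  VU x := by ext i; fin_cases i <;> simp
  VRU x := by ext i; fin_cases i <;> simp
  FoR x := by ext i; fin_cases i <;> simp
  FoU x := by ext i; fin_cases i <;> simp
  FzV h := h.elim
  FwB h := h.elim
  φwz := fun h => h
  γzw := fun h => h
  GzFo h := h.elim
  GwFo h := h.elim
  GoFz h := h.elim
  GoFw h := h.elim
  UGw h := h.elim
  BGz x := by ext i; fin_cases i <;> simp
  GoFo x := by ext i; fin_cases i <;> simp
  GzFz x := by ext i; fin_cases i <;> simp
  GwFz x := by ext i; fin_cases i <;> simp
  GzFw x := by ext i; fin_cases i <;> simp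
  GwFw x := by ext i; fin_cases i <;> simp
  RGo x := by ext i; fin_cases i <;> simp
  VGo x := by ext i; fin_cases i <;> simp
  FoGo x := by ext i; fin_cases i <;> simp
  FzGz x := by ext i; fin_cases i <;> simp
  FwGw x := by ext i; fin_cases i <;> simp

theorem familyNone_inj (c c' : ℚ) (o : (Fin 9 → ℚ) →ₗ[ℚ] Fin 9 → ℚ)
    (z : (Fin 5 → ℚ) →ₗ[ℚ] Fin 5 → ℚ) (w : (Fin 4 → ℚ) →ₗ[ℚ] Fin 4 → ℚ)
    (y : (Fin 2 → ℚ) →ₗ[ℚ] Fin 2 → ℚ) (ho : Function.Injective o)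
    (hR : ∀ t, (familyNone c').R (o t) = o ((familyNone c).R t))
    (hV : ∀ t, (familyNone c').V (o t) = z ((familyNone c).V t))
    (hB : ∀ t, (familyNone c').B (z t) = w ((familyNone c).B t))
    (hU : ∀ t, (familyNone c').U (w t) = o ((familyNone c).U t))
    (hFo : ∀ t, (familyNone c').Fo (o t) = y ((familyNone c).Fo t)) : c = c' := by
  have e1 : (familyNone c).V ![1, 0, 0, 0, 0, 0, 0, 0, 0] = 0 := by
    ext i; fin_cases i <;> simp [familyNone]
  have e2 : (familyNone c).B ((familyNone c).V ![0, 1, 0, 0, 0, 0, 0, 0, 0]) = 0 := by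
    ext i; fin_cases i <;> simp [familyNone]
  have e2' : (familyNone c).V ((familyNone c).R ![0, 1, 0, 0, 0, 0, 0, 0, 0]) = 0 := by
    ext i; fin_cases i <;> simp [familyNone]
  have e3 : (familyNone c).R ((familyNone c).R ![0, 0, 1, 0, 0, 0, 0, 0, 0]) = 0 := by
    ext i; fin_cases i <;> simp [familyNone]
  have e3' : (familyNone c).R ![0, 0, 1, 0, 0, 0, 0, 0, 0] = (familyNone c).U ![1, 0, 0, 0] := by
    ext i; fin_cases i <;> simp [familyNone]
  have e4 : (familyNone c).R ![0, 0, 0, 1, 0, 0, 0, 0, 0] =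
      (familyNone c).U ((familyNone c).B ![1, 0, 0, 0, 0]) := by
    ext i; fin_cases i <;> simp [familyNone]
  have e5 : (familyNone c).Fo (![1, 0, 0, 0, 0, 0, 0, 0, 0] + ![0, 0, 1, 0, 0, 0, 0, 0, 0] +
      ![0, 0, 0, 1, 0, 0, 0, 0, 0]) = 0 := by
    ext i; fin_cases i <;> simp [familyNone]
  have e6 : (familyNone c).Fo (![0, 1, 0, 0, 0, 0, 0, 0, 0] + ![0, 0, 1, 0, 0, 0, 0, 0, 0] +
      c • ![0, 0, 0, 1, 0, 0, 0, 0, 0]) = 0 := by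
    ext i; fin_cases i <;> simp [familyNone]
  have e7 : (familyNone c).R ((familyNone c).R ![0, 0, 0, 1, 0, 0, 0, 0, 0]) = ![0, 0, 0, 0, 0, 0, 0, 0, 1] := by
    ext i; fin_cases i <;> simp [familyNone]
  have h1 := congrArg z e1
  rw [← hV, map_zero] at h1
  have h2 := congrArg w e2
  rw [← hB, ← hV, map_zero] at h2
  have h2' := congrArg z e2'
  rw [← hV, ← hR, map_zero] at h2'
  have h3 := congrArg o e3
  rw [← hR, ← hR, map_zero] at h3
  have h3' := congrArg o e3'
  rw [← hR, ← hU] at h3'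
  have h4 := congrArg o e4
  rw [← hR, ← hU, ← hB] at h4
  have h5 := congrArg y e5
  rw [← hFo, map_add o, map_add o, map_zero] at h5
  have h6 := congrArg y e6
  rw [← hFo, map_add o, map_add o, map_smul, map_zero] at h6
  have h7 := congrArg o e7
  rw [← hR, ← hR] at h7
  have k11 := congrFun h1 1
  have k12 := congrFun h1 2
  have k13 := congrFun h1 3
  have k21 := congrFun h2 2
  have k22 := congrFun h2 3
  have k23 := congrFun h2' 4
  have k31 := congrFun h3 8
  have k32 := congrFun h3' 4
  have k33 := congrFun h3' 5
  have k41 := congrFun h4 4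
  have k42 := congrFun h4 5
  have k43 := congrFun h4 6
  have k51 := congrFun h5 0
  have k52 := congrFun h5 1
  have k61 := congrFun h6 0
  have k62 := congrFun h6 1
  simp [familyNone] at k11 k12 k13 k21 k22 k23 k31 k32 k33 k41 k42 k43 k51 k52 k61 k62
  have hd : o ![0, 0, 0, 1, 0, 0, 0, 0, 0] 3 ≠ 0 := by
    intro hd
    have : ![0, 0, 0, 0, 0, 0, 0, 0, 1] = (0 : Fin 9 → ℚ) := ho <| by
      rw [← h7, map_zero]
      ext i; fin_cases i <;> simp [familyNone, hd]
    simpa using congrFun this 8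
  simp only [k11, k12, k13, k21, k22, k23, k31, k32, k33, k41, k42, k43] at k51 k52 k61 k62
  apply mul_right_cancel₀ hd
  linear_combination k62 + c' * k51 - c' * k61 - c' * k52

end RayCategory

namespace RayCategory

variable {P : RayCategory} {o z y : P.Obj}

/-- A point `o` whose radical is generated by an irreducible loop of nilpotency index four, such
that all decisive subcategories with at most four points are representation-finite. -/
structure MildLoop (P : RayCategory) (o : P.Obj) : Prop where
  irreducible : P.IsIrreducible (P.pipow o 1)
  cube : P.pipow o 3 ≠ P.zero o o
  fourth : P.pipow o 4 = P.zero o o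
  repFin : ∀ D : Set P.Obj, o ∈ D →
    (∀ z ∈ D, ∃ g : P.Hom o z, ∀ h : P.Hom o z, g ≠ P.comp h (P.pipow o 3)) →
    D.Finite → D.ncard ≤ 4 → RepFin P D (IdealOf P (P.pipow o 3))

/-- The morphisms `v : o → z` and `u : z → o` satisfy `u v = π(o) ^ e`, and no smaller power
factors through `z`. -/
structure Factors (P : RayCategory) {o z : P.Obj} (v : P.Hom o z) (u : P.Hom z o) (e : ℕ) :
    Prop where
  ne : o ≠ z
  two_le : 2 ≤ e
  le_three : e ≤ 3
  comp_eq : P.comp u v = P.pipow o e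
  min : ∀ (g : P.Hom z o) (f : P.Hom o z) t, P.comp g f = P.pipow o t →
    P.pipow o t ≠ P.zero o o → e ≤ t

/-- Every morphism parallel to `p` is obtained from `p` by multiplication with a power of the
generator of one of the two radicals. -/
def Generates (P : RayCategory) {x y : P.Obj} (p : P.Hom x y) : Prop :=
  ∀ f : P.Hom x y, (∃ i, f = P.comp p (P.pipow x i)) ∨ ∃ i, f = P.comp (P.pipow y i) p

theorem exists_generates (x y : P.Obj) : ∃ p : P.Hom x y, P.Generates p := by
  obtain ⟨p, hp | hp⟩ := P.hom_cyclic x y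
  exacts [⟨p, fun f => .inr (hp f)⟩, ⟨p, fun f => .inl (hp f)⟩]

theorem IsIrreducible.on {x y : P.Obj} {f : P.Hom x y} (h : P.IsIrreducible f)
    (S : Set P.Obj) : P.IsIrreducibleOn S f :=
  ⟨h.1, h.2.1, fun z _ => h.2.2 z⟩

theorem Generates.ne_comp_pipow {x y : P.Obj} {p : P.Hom x y} (hp : P.Generates p)
    (h0 : p ≠ P.zero x y) (g : P.Hom x y) {i : ℕ} (hi : 1 ≤ i) :
    p ≠ P.comp g (P.pipow x i) := by
  intro h
  obtain ⟨k, rfl⟩ | ⟨k, rfl⟩ := hp g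
  · rw [P.assoc, ← pipow_add] at h
    exact h0 (eq_zero_of_absorb_right (by lia) h)
  · rw [P.assoc] at h
    exact h0 (eq_zero_of_absorb (by lia) h)

theorem Generates.ne_pipow_comp {x y : P.Obj} {p : P.Hom x y} (hp : P.Generates p)
    (h0 : p ≠ P.zero x y) (g : P.Hom x y) {i : ℕ} (hi : 1 ≤ i) :
    p ≠ P.comp (P.pipow y i) g := by
  intro h
  obtain ⟨k, rfl⟩ | ⟨k, rfl⟩ := hp g
  · exact h0 (eq_zero_of_absorb (by lia) h)
  · rw [← P.assoc, ← pipow_add] at h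
    exact h0 (eq_zero_of_absorb_left (by lia) h)

theorem Generates.isIrreducibleOn {x y : P.Obj} {p : P.Hom x y} (hp : P.Generates p)
    (h0 : p ≠ P.zero x y) (hxy : x ≠ y) {S : Set P.Obj}
    (hS : ∀ w ∈ S, w = x ∨ w = y ∨ ∀ (g : P.Hom w y) (h : P.Hom x w), p ≠ P.comp g h) :
    P.IsIrreducibleOn S p := by
  refine ⟨h0, not_isId_of_ne hxy p, fun w hw g h hgh => ?_⟩
  rcases hS w hw with rfl | rfl | hw
  · right
    by_contra hh
    obtain ⟨i, hi⟩ := eq_pipow_of_not_isId hh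
    rw [← pipow_add] at hi
    rw [hi] at hgh
    exact hp.ne_comp_pipow h0 g (by lia) hgh
  · left
    by_contra hh
    obtain ⟨i, hi⟩ := eq_pipow_of_not_isId hh
    rw [← pipow_add] at hi
    rw [hi] at hgh
    exact hp.ne_pipow_comp h0 h (by lia) hgh
  · exact absurd hgh (hw g h)

theorem exists_eq_comp_cube {f : P.Hom o z}
    (hf : IdealOf P (P.pipow o 3) o z f) : ∃ h : P.Hom o z, f = P.comp h (P.pipow o 3) := by
  obtain ⟨g, h, rfl⟩ := hf
  obtain ⟨m, rfl⟩ := P.endo_cyclic o h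
  exact ⟨P.comp g (P.pipow o m), by rw [P.assoc, ← pipow_add, ← pipow_add, add_comm]⟩

theorem exists_eq_cube_comp {f : P.Hom z o}
    (hf : IdealOf P (P.pipow o 3) z o f) : ∃ h : P.Hom z o, f = P.comp (P.pipow o 3) h := by
  obtain ⟨g, h, rfl⟩ := hf
  obtain ⟨m, rfl⟩ := P.endo_cyclic o g
  exact ⟨P.comp (P.pipow o m) h, by rw [← P.assoc, ← P.assoc, ← pipow_add, ← pipow_add,
    add_comm]⟩

namespace MildLoop

variable (L : MildLoop P o)
include L

theorem pipow_ne {t : ℕ} (ht : t ≤ 3) : P.pipow o t ≠ P.zero o o :=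
  fun h => L.cube (pipow_mono_zero ht h)

theorem pipow_eq_zero' {t : ℕ} (ht : 4 ≤ t) : P.pipow o t = P.zero o o :=
  pipow_mono_zero ht L.fourth

theorem le_three {t : ℕ} (ht : P.pipow o t ≠ P.zero o o) : t ≤ 3 := by
  by_contra h
  exact ht (L.pipow_eq_zero' (by lia))

theorem two_le (hoz : o ≠ z) (g : P.Hom z o) (f : P.Hom o z) {t : ℕ}
    (h : P.comp g f = P.pipow o t) : 2 ≤ t := by
  by_contra ht
  obtain rfl | rfl : t = 0 ∨ t = 1 := by lia
  · rw [P.pipow_zero] at h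
    exact hoz (eq_of_comp_eq_id h)
  · rcases L.irreducible.2.2 z g f h.symm with h | h
    · exact not_isId_of_ne (Ne.symm hoz) g h
    · exact not_isId_of_ne hoz f h

theorem id_ne (h : P.Hom o o) : P.id o ≠ P.comp h (P.pipow o 3) := by
  intro hh
  obtain ⟨m, rfl⟩ := P.endo_cyclic o h
  rw [← pipow_add, ← P.pipow_zero] at hh
  have := pipow_injective hh (L.pipow_ne (by lia))
  lia

/-- A morphism in the ideal can only contribute to high powers of the loop. -/
theorem three_le_of_mem {x y : P.Obj} {f : P.Hom x y} (hf : IdealOf P (P.pipow o 3) x y f)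
    {g : P.Hom y o} {h : P.Hom o x} {t : ℕ} (ht : t ≤ 3)
    (hh : P.comp g (P.comp f h) = P.pipow o t) : 3 ≤ t := by
  obtain ⟨g', h', rfl⟩ := hf
  obtain ⟨m, hm⟩ := P.endo_cyclic o (P.comp g g')
  obtain ⟨m', hm'⟩ := P.endo_cyclic o (P.comp h' h)
  rw [P.assoc, P.assoc, hm', ← P.assoc, hm, ← pipow_add, ← pipow_add] at hh
  have := pipow_injective hh.symm (L.pipow_ne ht)
  lia

theorem not_mem_id : ¬ IdealOf P (P.pipow o 3) o o (P.id o) := fun h => by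
  have := L.three_le_of_mem h (g := P.id o) (h := P.id o) (t := 0) (by lia)
    (by rw [P.comp_id, P.comp_id, P.pipow_zero])
  lia

theorem not_mem_pi : ¬ IdealOf P (P.pipow o 3) o o (P.pipow o 1) := fun h => by
  have := L.three_le_of_mem h (g := P.id o) (h := P.id o) (t := 1) (by lia)
    (by rw [P.comp_id, P.id_comp])
  lia

variable {v : P.Hom o z} {u : P.Hom z o} {e : ℕ}

theorem comp_eq_zero_of_mem (hoz : o ≠ z) {f : P.Hom o z} {g : P.Hom z o}
    (hf : IdealOf P (P.pipow o 3) o z f) : P.comp g f = P.zero o o := by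
  obtain ⟨h, rfl⟩ := exists_eq_comp_cube hf
  obtain ⟨t, ht⟩ := P.endo_cyclic o (P.comp g h)
  have := L.two_le hoz g h ht
  rw [← P.assoc, ht, ← pipow_add]
  exact L.pipow_eq_zero' (by lia)

theorem comp_eq_zero_of_mem' (hoz : o ≠ z) {f : P.Hom o z} {g : P.Hom z o}
    (hg : IdealOf P (P.pipow o 3) z o g) : P.comp g f = P.zero o o := by
  obtain ⟨h, rfl⟩ := exists_eq_cube_comp hg
  obtain ⟨t, ht⟩ := P.endo_cyclic o (P.comp h f)
  have := L.two_le hoz h f ht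
  rw [P.assoc, ht, ← pipow_add]
  exact L.pipow_eq_zero' (by lia)

theorem comp_ne (F : Factors P v u e) : P.comp u v ≠ P.zero o o := by
  rw [F.comp_eq]; exact L.pipow_ne F.le_three

theorem left_ne (F : Factors P v u e) : v ≠ P.zero o z := by
  rintro rfl; exact L.comp_ne F (P.comp_zero _)

theorem right_ne (F : Factors P v u e) : u ≠ P.zero z o := by
  rintro rfl; exact L.comp_ne F (P.zero_comp _)

theorem not_mem_left (F : Factors P v u e) : ¬ IdealOf P (P.pipow o 3) o z v :=
  fun h => L.comp_ne F (L.comp_eq_zero_of_mem F.ne h)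

theorem not_mem_right (F : Factors P v u e) : ¬ IdealOf P (P.pipow o 3) z o u :=
  fun h => L.comp_ne F (L.comp_eq_zero_of_mem' F.ne h)

theorem not_mem_id' (F : Factors P v u e) : ¬ IdealOf P (P.pipow o 3) z z (P.id z) := by
  rintro ⟨g, h, hh⟩
  refine L.not_mem_left F ⟨g, P.comp h v, ?_⟩
  rw [← P.assoc (P.pipow o 3), ← P.assoc, ← hh, P.id_comp]

theorem ne_comp_cube (F : Factors P v u e) (h : P.Hom o z) : v ≠ P.comp h (P.pipow o 3) :=
  fun hv => L.not_mem_left F ⟨h, P.id o, by rw [P.comp_id]; exact hv⟩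

/-- A product of two factorizations through `z` vanishes. -/
theorem comp_comp_eq_zero (hoz : o ≠ z) (g g' : P.Hom z o) (f f' : P.Hom o z) :
    P.comp g (P.comp f (P.comp g' f')) = P.zero o o := by
  obtain ⟨t, ht⟩ := P.endo_cyclic o (P.comp g f)
  obtain ⟨t', ht'⟩ := P.endo_cyclic o (P.comp g' f')
  have := L.two_le hoz g f ht
  have := L.two_le hoz g' f' ht'
  rw [ht', ← P.assoc, ht, ← pipow_add]
  exact L.pipow_eq_zero' (by lia)

theorem exists_pi_eq_comp (F : Factors P v u e) :
    ∃ (g : P.Hom o z) (h : P.Hom z o), P.pipow z 1 = P.comp g h := by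
  by_contra hno
  obtain ⟨p, hp⟩ := exists_generates (P := P) o z
  obtain ⟨q, hq⟩ := exists_generates (P := P) z o
  have hp0 : p ≠ P.zero o z := by
    rintro rfl
    rcases hp v with ⟨i, h⟩ | ⟨i, h⟩
    · exact L.left_ne F (h.trans (P.zero_comp _))
    · exact L.left_ne F (h.trans (P.comp_zero _))
  have hq0 : q ≠ P.zero z o := by
    rintro rfl
    rcases hq u with ⟨i, h⟩ | ⟨i, h⟩
    · exact L.right_ne F (h.trans (P.zero_comp _))
    · exact L.right_ne F (h.trans (P.comp_zero _))
  have ht : P.IsIrreducibleOn {o, z} (P.pipow z 1) := by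
    have h0 : P.pipow z 1 ≠ P.zero z z := fun h =>
      hno ⟨P.zero _ _, P.zero _ _, h.trans (P.comp_zero _).symm⟩
    refine ⟨h0, fun h => ?_, fun w hw g h hgh => ?_⟩
    · rw [isId_iff, ← P.pipow_zero] at h
      have := pipow_injective h h0
      lia
    · rcases hw with rfl | rfl
      · exact absurd ⟨g, h, hgh⟩ hno
      · by_contra! hn
        obtain ⟨i, hi⟩ := eq_pipow_of_not_isId hn.1
        obtain ⟨j, hj⟩ := eq_pipow_of_not_isId hn.2
        rw [hi, hj, ← pipow_add, ← pipow_add, ← pipow_add] at hgh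
        have := pipow_injective hgh h0
        lia
  refine not_repFin_two_loops (IdealOf P (P.pipow o 3)) F.ne (P.pipow o 1) p q (P.pipow z 1)
    (L.irreducible.on _) (hp.isIrreducibleOn hp0 F.ne ?_)
    (hq.isIrreducibleOn hq0 F.ne.symm ?_) ht L.not_mem_pi ?_ ?_ ?_ L.not_mem_id
    (L.not_mem_id' F) (L.repFin _ ?_ ?_ ?_ ?_)
  · rintro w (rfl | rfl) <;> simp
  · rintro w (rfl | rfl) <;> simp
  · rintro ⟨g, h, hh⟩
    rcases hp v with ⟨i, hi⟩ | ⟨i, hi⟩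
    · exact L.not_mem_left F ⟨g, P.comp h (P.pipow o i), by rw [hi, hh]; simp only [P.assoc]⟩
    · exact L.not_mem_left F ⟨P.comp (P.pipow z i) g, h, by rw [hi, hh]; simp only [P.assoc]⟩
  · rintro ⟨g, h, hh⟩
    rcases hq u with ⟨i, hi⟩ | ⟨i, hi⟩
    · exact L.not_mem_right F ⟨g, P.comp h (P.pipow z i), by rw [hi, hh]; simp only [P.assoc]⟩
    · exact L.not_mem_right F ⟨P.comp (P.pipow o i) g, h, by rw [hi, hh]; simp only [P.assoc]⟩
  · rintro ⟨g, h, hh⟩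
    exact hno ⟨g, _, hh⟩
  · simp
  · rintro w (rfl | rfl)
    · exact ⟨P.id w, L.id_ne⟩
    · exact ⟨v, L.ne_comp_cube F⟩
  · exact Set.toFinite _
  · exact (Set.ncard_insert_le _ _).trans (by simp)

theorem comp_pipow_comp_eq_zero (F : Factors P v u e) (g : P.Hom z o) (f : P.Hom o z) {i : ℕ}
    (hi : 1 ≤ i) : P.comp g (P.comp (P.pipow z i) f) = P.zero o o := by
  obtain ⟨a, b, hab⟩ := L.exists_pi_eq_comp F
  obtain ⟨j, rfl⟩ := Nat.exists_eq_add_of_le' hi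
  rw [pipow_add, hab]
  have := L.comp_comp_eq_zero F.ne (P.comp g (P.pipow z j)) b a f
  simpa only [P.assoc] using this

theorem generates_left (F : Factors P v u e) : P.Generates v := by
  obtain ⟨p, hp⟩ := exists_generates (P := P) o z
  have : v = p := by
    rcases hp v with ⟨i, hi⟩ | ⟨i, hi⟩
    · have h := F.comp_eq
      obtain ⟨t, ht⟩ := P.endo_cyclic o (P.comp u p)
      rw [hi, ← P.assoc, ht, ← pipow_add] at h
      have h0 := L.pipow_ne F.le_three
      have h1 := pipow_injective h.symm h0
      have h2 := F.min u p t ht (fun hz => h0 (by rw [← h]; exact pipow_mono_zero (by lia) hz))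
      obtain rfl : i = 0 := by lia
      rw [hi, P.pipow_zero, P.comp_id]
    · by_cases h : 1 ≤ i
      · refine absurd ?_ (L.comp_ne F)
        rw [hi]
        exact L.comp_pipow_comp_eq_zero F u p h
      · obtain rfl : i = 0 := by lia
        rw [hi, P.pipow_zero, P.id_comp]
  rwa [this]

theorem generates_right (F : Factors P v u e) : P.Generates u := by
  obtain ⟨q, hq⟩ := exists_generates (P := P) z o
  have : u = q := by
    rcases hq u with ⟨i, hi⟩ | ⟨i, hi⟩
    · by_cases h : 1 ≤ i
      · refine absurd ?_ (L.comp_ne F)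
        rw [hi, P.assoc]
        exact L.comp_pipow_comp_eq_zero F q v h
      · obtain rfl : i = 0 := by lia
        rw [hi, P.pipow_zero, P.comp_id]
    · have h := F.comp_eq
      obtain ⟨t, ht⟩ := P.endo_cyclic o (P.comp q v)
      rw [hi, P.assoc, ht, ← pipow_add] at h
      have h0 := L.pipow_ne F.le_three
      have h1 := pipow_injective h.symm h0
      have h2 := F.min q v t ht (fun hz => h0 (by rw [← h]; exact pipow_mono_zero (by lia) hz))
      obtain rfl : i = 0 := by lia
      rw [hi, P.pipow_zero, P.id_comp]
  rwa [this]

/-- Any factorization of `π(o) ^ e` through `z` is the given one. -/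
theorem eq_of_comp_eq (F : Factors P v u e) {g : P.Hom z o} {f : P.Hom o z}
    (h : P.comp g f = P.pipow o e) : g = u ∧ f = v := by
  have h0 := L.pipow_ne F.le_three
  have F' : Factors P f g e := ⟨F.ne, F.two_le, F.le_three, h, F.min⟩
  constructor
  · rcases L.generates_right F g with ⟨i, hi⟩ | ⟨i, hi⟩
    · rcases Nat.eq_zero_or_pos i with rfl | hi'
      · rw [hi, P.pipow_zero, P.comp_id]
      · exact absurd hi ((L.generates_right F').ne_comp_pipow (L.right_ne F') u hi')
    · rcases Nat.eq_zero_or_pos i with rfl | hi'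
      · rw [hi, P.pipow_zero, P.id_comp]
      · exact absurd hi ((L.generates_right F').ne_pipow_comp (L.right_ne F') u hi')
  · rcases L.generates_left F f with ⟨i, hi⟩ | ⟨i, hi⟩
    · rcases Nat.eq_zero_or_pos i with rfl | hi'
      · rw [hi, P.pipow_zero, P.comp_id]
      · exact absurd hi ((L.generates_left F').ne_comp_pipow (L.left_ne F') v hi')
    · rcases Nat.eq_zero_or_pos i with rfl | hi'
      · rw [hi, P.pipow_zero, P.id_comp]
      · exact absurd hi ((L.generates_left F').ne_pipow_comp (L.left_ne F') v hi')

/-- Two factorizations through different points are related by a morphism. -/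
theorem exists_factorization {f : P.Hom o y} {g : P.Hom y o} {e' : ℕ} (F : Factors P v u e)
    (F' : Factors P f g e') (hzy : z ≠ y) :
    (∃ (k : P.Hom y z) (h : P.Hom o y), v = P.comp k h) ∨
    (∃ (k : P.Hom y o) (h : P.Hom z y), u = P.comp k h) ∨
    (∃ (k : P.Hom z y) (h : P.Hom o z), f = P.comp k h) ∨
    (∃ (k : P.Hom z o) (h : P.Hom y z), g = P.comp k h) := by
  by_contra! hn
  obtain ⟨h1, h2, h3, h4⟩ := hn
  refine not_repFin_star (IdealOf P (P.pipow o 3)) F.ne F'.ne hzy (P.pipow o 1) v u f g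
    (L.irreducible.on _) ((L.generates_left F).isIrreducibleOn (L.left_ne F) F.ne ?_)
    ((L.generates_right F).isIrreducibleOn (L.right_ne F) F.ne.symm ?_)
    ((L.generates_left F').isIrreducibleOn (L.left_ne F') F'.ne ?_)
    ((L.generates_right F').isIrreducibleOn (L.right_ne F') F'.ne.symm ?_)
    L.not_mem_pi (L.not_mem_left F) (L.not_mem_right F) (L.not_mem_left F')
    (L.not_mem_right F') L.not_mem_id (L.not_mem_id' F) (L.not_mem_id' F')
    (L.repFin _ ?_ ?_ ?_ ?_)
  · rintro w (rfl | rfl | rfl)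
    exacts [.inl rfl, .inr (.inl rfl), .inr (.inr h1)]
  · rintro w (rfl | rfl | rfl)
    exacts [.inr (.inl rfl), .inl rfl, .inr (.inr h2)]
  · rintro w (rfl | rfl | rfl)
    exacts [.inl rfl, .inr (.inr h3), .inr (.inl rfl)]
  · rintro w (rfl | rfl | rfl)
    exacts [.inr (.inl rfl), .inr (.inr h4), .inl rfl]
  · simp
  · rintro w (rfl | rfl | rfl)
    exacts [⟨P.id w, L.id_ne⟩, ⟨v, L.ne_comp_cube F⟩, ⟨f, L.ne_comp_cube F'⟩]
  · exact Set.toFinite _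
  · exact (Set.ncard_insert_le _ _).trans (by rw [Set.ncard_pair hzy]; simp)

end MildLoop

end RayCategory

namespace RayCategory

variable {P : RayCategory} {o z w y : P.Obj}

/-- A factorization `u v = π(o)²` through another point with `v u = 0`. -/
structure Cycle (P : RayCategory) {o z : P.Obj} (v : P.Hom o z) (u : P.Hom z o) : Prop extends
    Factors P v u 2 where
  left_right : P.comp v u = P.zero z z

namespace Cycle

variable {v : P.Hom o z} {u : P.Hom z o} (C : Cycle P v u)
include C

theorem left_pipow {i : ℕ} (hi : 2 ≤ i) : P.comp v (P.pipow o i) = P.zero o z := by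
  obtain ⟨j, rfl⟩ := Nat.exists_eq_add_of_le hi
  rw [pipow_add, ← C.comp_eq, P.assoc, ← P.assoc, C.left_right, P.zero_comp]

variable (L : MildLoop P o)
include L

theorem left_pi_ne : P.comp v (P.pipow o 1) ≠ P.zero o z := by
  intro h
  refine L.cube ?_
  rw [show 3 = 2 + 1 from rfl, pipow_add, ← C.comp_eq, P.assoc, h, P.comp_zero]

theorem pipow_left {i : ℕ} (hi : 1 ≤ i) : P.comp (P.pipow z i) v = P.zero o z := by
  obtain ⟨g, h, hgh⟩ := L.exists_pi_eq_comp C.toFactors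
  obtain ⟨j, rfl⟩ := Nat.exists_eq_add_of_le' hi
  obtain ⟨t, ht⟩ := P.endo_cyclic o (P.comp h v)
  have h2 := L.two_le C.ne h v ht
  rw [pipow_add, hgh, P.assoc, P.assoc, ht]
  rcases L.generates_left C.toFactors g with ⟨i, rfl⟩ | ⟨i, rfl⟩
  · rw [P.assoc, ← pipow_add, C.left_pipow (by lia), P.comp_zero]
  · rw [P.assoc, C.left_pipow h2, P.comp_zero, P.comp_zero]

theorem hom_left (f : P.Hom o z) :
    f = P.zero o z ∨ f = v ∨ f = P.comp v (P.pipow o 1) := by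
  rcases L.generates_left C.toFactors f with ⟨i, rfl⟩ | ⟨i, rfl⟩
  · match i with
    | 0 => exact .inr (.inl (by rw [P.pipow_zero, P.comp_id]))
    | 1 => exact .inr (.inr rfl)
    | i + 2 => exact .inl (C.left_pipow (by lia))
  · match i with
    | 0 => exact .inr (.inl (by rw [P.pipow_zero, P.id_comp]))
    | i + 1 => exact .inl (C.pipow_left L (by lia))

theorem endo (g : P.Hom z z) : g = P.id z ∨ P.comp g v = P.zero o z := by
  obtain ⟨i, rfl⟩ := P.endo_cyclic z g
  rcases Nat.eq_zero_or_pos i with rfl | hi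
  · exact .inl (P.pipow_zero z)
  · exact .inr (C.pipow_left L hi)

theorem pipow_comp {i : ℕ} (hi : 1 ≤ i) (f : P.Hom o z) :
    P.comp (P.pipow z i) f = P.zero o z := by
  rcases C.hom_left L f with rfl | rfl | rfl
  · exact P.comp_zero _
  · exact C.pipow_left L hi
  · rw [← P.assoc, C.pipow_left L hi, P.zero_comp]

theorem right_comp_ne {f : P.Hom o z} (hf : f ≠ P.zero o z) : P.comp u f ≠ P.zero o o := by
  rcases C.hom_left L f with rfl | rfl | rfl
  · exact absurd rfl hf
  · exact L.comp_ne C.toFactors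
  · rw [← P.assoc, C.comp_eq, ← pipow_add]
    exact L.cube

theorem left_ne_left_pi : v ≠ P.comp v (P.pipow o 1) :=
  fun h => L.left_ne C.toFactors (eq_zero_of_absorb_right le_rfl h)

theorem comp_ne_left_pi (g : P.Hom z z) : P.comp g v ≠ P.comp v (P.pipow o 1) := by
  rcases C.endo L g with rfl | h
  · rw [P.id_comp]
    exact C.left_ne_left_pi L
  · rw [h]
    exact (C.left_pi_ne L).symm

variable {b : P.Hom z w} {u' : P.Hom w o} (C' : Cycle P (P.comp b v) u')
include C'

theorem comp_ne_comp_left_pi (g : P.Hom z w) :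
    P.comp g v ≠ P.comp (P.comp b v) (P.pipow o 1) := by
  intro hg
  have hv := L.left_ne C'.toFactors
  have key : P.comp g v = P.comp b v ∨ P.comp g v = P.zero o w := by
    obtain ⟨p, hp | hp⟩ := P.hom_cyclic z w
    · obtain ⟨i, hi⟩ := hp b
      obtain ⟨j, hj⟩ := hp g
      obtain rfl : i = 0 := by
        by_contra h
        refine hv ?_
        rw [hi, P.assoc]
        exact C'.pipow_comp L (by lia) _
      rw [P.pipow_zero, P.id_comp] at hi
      rw [hj, ← hi, P.assoc]
      rcases Nat.eq_zero_or_pos j with rfl | h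
      · rw [P.pipow_zero, P.id_comp]
        exact .inl rfl
      · exact .inr (C'.pipow_left L h)
    · obtain ⟨i, hi⟩ := hp b
      obtain ⟨j, hj⟩ := hp g
      obtain rfl : i = 0 := by
        by_contra h
        refine hv ?_
        rw [hi, P.assoc, C.pipow_left L (by lia), P.comp_zero]
      rw [P.pipow_zero, P.comp_id] at hi
      rw [hj, ← hi, P.assoc]
      rcases Nat.eq_zero_or_pos j with rfl | h
      · rw [P.pipow_zero, P.id_comp]
        exact .inl rfl
      · rw [C.pipow_left L h, P.comp_zero]
        exact .inr rfl
  rcases key with h | h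
  · exact C'.left_ne_left_pi L (h.symm.trans hg)
  · exact C'.left_pi_ne L (hg.symm.trans h)

theorem comp_comp_left_eq_zero (hzw : z ≠ w) (g : P.Hom w z) :
    P.comp g (P.comp b v) = P.zero o z := by
  have key : P.comp (P.comp b g) (P.comp b v) = P.zero o w := by
    rcases C'.endo L (P.comp b g) with h | h
    · exact absurd (eq_of_comp_eq_id h).symm hzw
    · exact h
  rcases C.hom_left L (P.comp g (P.comp b v)) with h | h | h
  · exact h
  · rw [P.assoc, h] at key
    exact absurd key (L.left_ne C'.toFactors)
  · rw [P.assoc, h, ← P.assoc] at key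
    exact absurd key (C'.left_pi_ne L)

end Cycle

namespace MildLoop

variable {v : P.Hom o z} {b : P.Hom z w} {u : P.Hom w o} {f : P.Hom o y}

theorem fourPoints (L : MildLoop P o) {u' : P.Hom z o} (C : Cycle P v u')
    (C' : Cycle P (P.comp b v) u) (hzw : z ≠ w) (hoy : o ≠ y) (hzy : z ≠ y) (hwy : w ≠ y)
    (hf : f ≠ P.zero o y) (hgen : P.Generates f)
    (hleft : ∀ (t : P.Hom o y) (h : P.Hom y o), P.comp h t ≠ P.zero o o → t = f)
    (hlabel : ∀ (g : P.Hom y o) d, d < 3 → P.comp g f ≠ P.pipow o d) :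
    FourPoints P v b u f where
  oz := C.ne
  ow := C'.ne
  oy := hoy
  zw := hzw
  zy := hzy
  wy := hwy
  cube := L.cube
  fourth := L.fourth
  square := C'.comp_eq
  vr := C.left_pi_ne L
  bvr := C'.left_pi_ne L
  f_ne := hf
  hom_z := C.hom_left L
  hom_w := C'.hom_left L
  left_o := hleft
  left_z t h ht := hleft t (P.comp u' h) (by rw [P.assoc]; exact C.right_comp_ne L ht)
  left_w t h ht := hleft t (P.comp u h) (by rw [P.assoc]; exact C'.right_comp_ne L ht)
  left_y t h ht := by
    obtain ⟨i, rfl⟩ := P.endo_cyclic y h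
    rcases Nat.eq_zero_or_pos i with rfl | hi
    · rwa [P.pipow_zero, P.id_comp] at ht
    · exact absurd ht.symm (hgen.ne_pipow_comp hf t hi)
  right_y t d ht := by
    rcases Nat.eq_zero_or_pos d with rfl | hi
    · rwa [P.pipow_zero, P.comp_id] at ht
    · exact absurd ht.symm (hgen.ne_comp_pipow hf t hi)
  label_zo g d _ h := L.two_le C.ne g v h
  label_wo g d _ h := L.two_le C'.ne g _ h
  label_zz := C.comp_ne_left_pi L
  label_ww := C'.comp_ne_left_pi L
  label_zw := C.comp_ne_comp_left_pi L C'
  label_wz := C.comp_comp_left_eq_zero L C' hzw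
  label_yo := hlabel
  label_yz g h := hlabel (P.comp u' g) 2 (by lia) (by rw [P.assoc, h, C.comp_eq])
  label_yw g h := hlabel (P.comp u g) 2 (by lia) (by rw [P.assoc, h, C'.comp_eq])

theorem repFin_four (L : MildLoop P o) {u' : P.Hom z o} (C : Cycle P v u')
    (C' : Cycle P (P.comp b v) u) (hf : f ≠ P.zero o y) (hgen : P.Generates f) :
    RepFin P {o, z, w, y} (IdealOf P (P.pipow o 3)) := by
  refine L.repFin _ (by simp) ?_ (Set.toFinite _) ?_
  · rintro w (rfl | rfl | rfl | rfl)
    exacts [⟨P.id w, L.id_ne⟩, ⟨v, L.ne_comp_cube C.toFactors⟩,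
      ⟨P.comp b v, L.ne_comp_cube C'.toFactors⟩,
      ⟨f, fun h => hgen.ne_comp_pipow hf h (by lia)⟩]
  · calc ({o, z, w, y} : Set P.Obj).ncard ≤ ({w, y} : Set P.Obj).ncard + 1 + 1 :=
        (Set.ncard_insert_le _ _).trans (Nat.succ_le_succ (Set.ncard_insert_le _ _))
      _ ≤ 4 := Nat.add_le_add_right (Nat.add_le_add_right
        ((Set.ncard_insert_le _ _).trans (by simp)) 1) 1

end MildLoop

end RayCategory

namespace RayCategory

variable {P : RayCategory}

/-- The part of the structure of a penny-farthing with `n ≥ 3` points that is used below: `v i` and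
`u i` are the compositions of the arrows from `x 0` to `x i` and from `x i` to `x n = x 0`. -/
structure Penny (P : RayCategory) (n : ℕ) (x : ℕ → P.Obj) (a : ∀ i, P.Hom (x i) (x (i + 1)))
    (v : ∀ i, P.Hom (x 0) (x i)) (u : ∀ i, P.Hom (x i) (x 0)) : Prop where
  three_le : 3 ≤ n
  loop : MildLoop P (x 0)
  irreducible : ∀ i, P.IsIrreducible (a i)
  ne : ∀ i j, i < j → j < n → x i ≠ x j
  v_zero : v 0 = P.id (x 0)
  v_succ : ∀ i, v (i + 1) = P.comp (a i) (v i)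
  comp_eq : ∀ i, i ≤ n → P.comp (u i) (v i) = P.pipow (x 0) 2
  left_right : ∀ i, 1 ≤ i → i < n → P.comp (v i) (u i) = P.zero (x i) (x i)
  closed : ∃ j : P.Hom (x 0) (x n), P.comp j (P.pipow (x 0) 2) = v n ∧
    P.comp (u n) j = P.id (x 0)

/-- A property that fails to propagate to `n` breaks down at some step. -/
theorem exists_step {p : ℕ → Prop} {n : ℕ} (h0 : p 0) (hn : ¬ p n) :
    ∃ i < n, p i ∧ ¬ p (i + 1) := by
  by_contra! h
  have : ∀ i ≤ n, p i := fun i => by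
    induction i with
    | zero => exact fun _ => h0
    | succ i ih => exact fun hi => h i (by lia) (ih (by lia))
  exact hn (this n le_rfl)

namespace Penny

variable {n : ℕ} {x : ℕ → P.Obj} {a : ∀ i, P.Hom (x i) (x (i + 1))}
  {v : ∀ i, P.Hom (x 0) (x i)} {u : ∀ i, P.Hom (x i) (x 0)} (H : Penny P n x a v u)
  {y : P.Obj}
include H

theorem cycle {i : ℕ} (hi : 1 ≤ i) (hn : i < n) : Cycle P (v i) (u i) where
  ne := H.ne 0 i hi hn
  two_le := le_rfl
  le_three := by lia
  comp_eq := H.comp_eq i hn.le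
  min g f _ h _ := H.loop.two_le (H.ne 0 i hi hn) g f h
  left_right := H.left_right i hi hn

theorem exists_comp_v_zero (f : P.Hom (x 0) y) : ∃ k : P.Hom (x 0) y, f = P.comp k (v 0) :=
  ⟨f, by rw [H.v_zero, P.comp_id]⟩

theorem comp_ne_square (hy : ∀ i, x i ≠ y) (g : P.Hom y (x 0)) (f : P.Hom (x 0) y) :
    P.comp g f ≠ P.pipow (x 0) 2 := by
  intro hgf
  have L := H.loop
  have F' : Factors P f g 2 :=
    ⟨hy 0, le_rfl, by lia, hgf, fun g f _ h _ => L.two_le (hy 0) g f h⟩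
  obtain ⟨j, hj, hj'⟩ := H.closed
  have hn : ¬ ∃ k : P.Hom (x n) y, f = P.comp k (v n) := by
    rintro ⟨k, hk⟩
    obtain ⟨m, hm⟩ := P.endo_cyclic (x 0) (P.comp g (P.comp k j))
    have h := hgf
    rw [hk, ← hj, ← P.assoc k, ← P.assoc, hm, ← pipow_add] at h
    have h' := pipow_injective h.symm (L.pipow_ne (by lia))
    obtain rfl : m = 0 := by lia
    rw [P.pipow_zero] at hm
    exact hy 0 (eq_of_comp_eq_id hm)
  obtain ⟨i, hin, ⟨k, hk⟩, hi⟩ := exists_step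
    (p := fun i => ∃ k : P.Hom (x i) y, f = P.comp k (v i)) (H.exists_comp_v_zero f) hn
  by_cases hG : ∃ k : P.Hom y (x (i + 1)), v (i + 1) = P.comp k f
  · obtain ⟨k', hk'⟩ := hG
    have he := H.comp_eq (i + 1) hin
    have : a i = P.comp k' k := by
      refine P.cancel (v i) _ _ (u (i + 1)) ?_ ?_
      · rw [← H.v_succ, P.assoc, ← hk, hk']
      · rw [← H.v_succ, he]
        exact L.pipow_ne (by lia)
    rcases (H.irreducible i).2.2 y k' k this with h | h
    · exact not_isId_of_ne (hy _).symm _ h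
    · exact not_isId_of_ne (hy _) _ h
  · have hin' : i + 1 < n := by
      by_contra h
      obtain rfl : n = i + 1 := by lia
      exact hG ⟨P.comp j g, by rw [P.assoc, hgf, hj]⟩
    have C := H.cycle (Nat.succ_pos i) hin'
    rcases L.exists_factorization C.toFactors F' (hy (i + 1)) with
      ⟨k, h, e⟩ | ⟨k, h, e⟩ | ⟨k, h, e⟩ | ⟨k, h, e⟩
    · have := (L.eq_of_comp_eq F' (g := P.comp (u (i + 1)) k) (f := h)
        (by rw [P.assoc, ← e, C.comp_eq])).2
      exact hG ⟨k, by rw [e, this]⟩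
    · have := (L.eq_of_comp_eq F' (g := k) (f := P.comp h (v (i + 1)))
        (by rw [← P.assoc, ← e, C.comp_eq])).2
      exact hi ⟨h, this.symm⟩
    · have := (L.eq_of_comp_eq C.toFactors (g := P.comp g k) (f := h)
        (by rw [P.assoc, ← e, hgf])).2
      exact hi ⟨k, by rw [e, this]⟩
    · have := (L.eq_of_comp_eq C.toFactors (g := k) (f := P.comp h f)
        (by rw [← P.assoc, ← e, hgf])).2
      exact hG ⟨h, this.symm⟩

/-- The four points spanned by two consecutive points of the cycle and a point outside. -/
theorem fourPoints (hy : ∀ i, x i ≠ y) {i : ℕ} (hi : 1 ≤ i) (hn : i + 1 < n)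
    {f : P.Hom (x 0) y} (hf : f ≠ P.zero (x 0) y) (hgen : P.Generates f)
    (hleft : ∀ (t : P.Hom (x 0) y) (h : P.Hom y (x 0)), P.comp h t ≠ P.zero _ _ → t = f)
    (hlabel : ∀ (g : P.Hom y (x 0)) d, d < 3 → P.comp g f ≠ P.pipow (x 0) d) :
    FourPoints P (v i) (a i) (u (i + 1)) f := by
  have C' := H.cycle (Nat.succ_pos i) hn
  rw [H.v_succ] at C'
  exact H.loop.fourPoints (H.cycle hi (by lia)) C' (H.ne i (i + 1) (by lia) hn) (hy _) (hy _)
    (hy _) hf hgen hleft hlabel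

theorem repFin_four {i : ℕ} (hi : 1 ≤ i) (hn : i + 1 < n)
    {f : P.Hom (x 0) y} (hf : f ≠ P.zero (x 0) y) (hgen : P.Generates f) :
    RepFin P {x 0, x i, x (i + 1), y} (IdealOf P (P.pipow (x 0) 3)) := by
  have C' := H.cycle (Nat.succ_pos i) hn
  rw [H.v_succ] at C'
  exact H.loop.repFin_four (H.cycle hi (by lia)) C' hf hgen

theorem comp_pi_eq {i : ℕ} (hi : i ≤ n) :
    P.comp (u i) (P.comp (v i) (P.pipow (x 0) 1)) = P.pipow (x 0) 3 := by
  rw [← P.assoc, H.comp_eq i hi, ← pipow_add]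

theorem comp_ne_cube (hy : ∀ i, x i ≠ y) (g : P.Hom y (x 0)) (f : P.Hom (x 0) y) :
    P.comp g f ≠ P.pipow (x 0) 3 := by
  intro hgf
  have L := H.loop
  have hmin : ∀ (g : P.Hom y (x 0)) (f : P.Hom (x 0) y) t, P.comp g f = P.pipow (x 0) t →
      3 ≤ t := fun g f t h => by
    have := L.two_le (hy 0) g f h
    by_contra h3
    obtain rfl : t = 2 := by lia
    exact H.comp_ne_square hy g f h
  have F' : Factors P f g 3 := ⟨hy 0, by lia, le_rfl, hgf, fun g f t h _ => hmin g f t h⟩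
  have hf := L.left_ne F'
  have hgen := L.generates_left F'
  have hleft : ∀ (t : P.Hom (x 0) y) (h : P.Hom y (x 0)), P.comp h t ≠ P.zero _ _ → t = f := by
    intro t h ht
    rcases hgen t with ⟨i, rfl⟩ | ⟨i, rfl⟩
    · obtain ⟨m, hm⟩ := P.endo_cyclic (x 0) (P.comp h f)
      have := hmin h f m hm
      rw [← P.assoc, hm, ← pipow_add] at ht
      have := L.le_three ht
      obtain rfl : i = 0 := by lia
      rw [P.pipow_zero, P.comp_id]
    · rcases Nat.eq_zero_or_pos i with rfl | hi
      · rw [P.pipow_zero, P.id_comp]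
      · exact absurd (L.comp_pipow_comp_eq_zero F' h f hi) ht
  have hlabel : ∀ (g : P.Hom y (x 0)) d, d < 3 → P.comp g f ≠ P.pipow (x 0) d :=
    fun g d hd h => by
      have := hmin g f d h
      lia
  obtain ⟨j, hj, hj'⟩ := H.closed
  have hn : ¬ ∃ k : P.Hom (x n) y, f = P.comp k (v n) := by
    rintro ⟨k, hk⟩
    rw [← hj, ← P.assoc] at hk
    exact hgen.ne_comp_pipow hf _ (by lia) hk
  obtain ⟨i, hin, ⟨k, hk⟩, hi⟩ := exists_step
    (p := fun i => ∃ k : P.Hom (x i) y, f = P.comp k (v i)) (H.exists_comp_v_zero f) hn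
  have h3 := H.three_le
  by_cases hG : ∃ k' : P.Hom y (x (i + 1)), g = P.comp (u (i + 1)) k'
  · obtain ⟨k', hk'⟩ := hG
    rcases Nat.eq_zero_or_pos i with rfl | hi0
    · have C := H.cycle le_rfl (show 1 < n by lia)
      have key : P.comp k' f = P.comp (v 1) (P.pipow (x 0) 1) := by
        have e : P.comp (u 1) (P.comp (P.comp k' f) (P.id _)) = P.pipow (x 0) 3 := by
          rw [P.comp_id, ← P.assoc, ← hk', hgf]
        refine P.cancel (P.id _) _ _ (u 1) ?_ (by rw [e]; exact L.cube)
        rw [e, P.comp_id, H.comp_pi_eq (by lia)]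
      refine (H.fourPoints hy le_rfl (show 1 + 1 < n by lia) hf hgen hleft hlabel).not_repFin
        (iff_false_intro fun ⟨k, e⟩ => hi ⟨k, e.symm⟩)
        (iff_false_intro fun ⟨k, e⟩ => hi ⟨P.comp k (a 1), by rw [P.assoc, e]⟩)
        (iff_true_intro ⟨g, hgf⟩) (iff_true_intro ⟨k', key⟩)
        (iff_true_intro ⟨P.comp (a 1) k', by rw [P.assoc, key, P.assoc]⟩)
        _ familyGamma
        (fun c c' o z w y ho _ hR hV hB _ hFo _ _ _ hGz _ =>
          familyGamma_inj c c' o z w y ho hR hV hB hFo (hGz trivial))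
        (H.repFin_four le_rfl (show 1 + 1 < n by lia) hf hgen)
    · by_cases hin' : i + 1 < n
      · have C := H.cycle hi0 hin
        have C' := H.cycle (Nat.succ_pos i) hin'
        have key : P.comp (P.comp k' k) (v i) = P.comp (v (i + 1)) (P.pipow (x 0) 1) := by
          have e : P.comp (u (i + 1)) (P.comp (P.comp (P.comp k' k) (v i)) (P.id _)) =
              P.pipow (x 0) 3 := by
            rw [P.comp_id, P.assoc, ← hk, ← P.assoc, ← hk', hgf]
          refine P.cancel (P.id _) _ _ (u (i + 1)) ?_ (by rw [e]; exact L.cube)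
          rw [e, P.comp_id, H.comp_pi_eq hin]
        rw [H.v_succ] at key C'
        exact C.comp_ne_comp_left_pi L C' _ key
      · obtain ⟨i, rfl⟩ := Nat.exists_eq_add_of_le' hi0
        have C := H.cycle (show 1 ≤ i by lia) (by lia)
        have C' := H.cycle (Nat.succ_pos i) hin
        rw [H.v_succ] at C' hk
        have hne := H.ne i (i + 1) (by lia) hin
        refine (H.fourPoints hy (show 1 ≤ i by lia) hin hf hgen hleft hlabel).not_repFin
          (iff_true_intro ⟨P.comp k (a i), by rw [P.assoc, hk]⟩)
          (iff_true_intro ⟨k, hk.symm⟩) (iff_true_intro ⟨g, hgf⟩)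
          (iff_false_intro fun ⟨g', e⟩ => ?_) (iff_false_intro fun ⟨g', e⟩ => ?_)
          _ familyO
          (fun c c' o z w y ho _ hR _ hB hU _ _ hFw hGo _ _ =>
            familyO_inj c c' o z w y ho hR hB hU (hFw trivial) (hGo trivial))
          (H.repFin_four (show 1 ≤ i by lia) hin hf hgen)
        · rw [hk, ← P.assoc, C.comp_comp_left_eq_zero L C' hne] at e
          exact C.left_pi_ne L e.symm
        · rw [hk, ← P.assoc] at e
          exact C'.comp_ne_left_pi L _ e
  · have hin' : i + 1 < n := by
      by_contra h
      obtain rfl : n = i + 1 := by lia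
      exact hG ⟨P.comp j g, by rw [← P.assoc, hj', P.id_comp]⟩
    have C := H.cycle (Nat.succ_pos i) hin'
    have F := C.toFactors
    rcases L.exists_factorization F F' (hy (i + 1)) with
      ⟨k, h, e⟩ | ⟨k, h, e⟩ | ⟨k, h, e⟩ | ⟨k, h, e⟩
    · exact H.comp_ne_square hy (P.comp (u (i + 1)) k) h (by rw [P.assoc, ← e, C.comp_eq])
    · exact H.comp_ne_square hy k (P.comp h (v (i + 1))) (by rw [← P.assoc, ← e, C.comp_eq])
    · rcases L.generates_left F h with ⟨m, rfl⟩ | ⟨m, rfl⟩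
      · rcases Nat.eq_zero_or_pos m with rfl | hm
        · exact hi ⟨k, by rw [e, P.pipow_zero, P.comp_id]⟩
        · rw [← P.assoc] at e
          exact hgen.ne_comp_pipow hf _ hm e
      · rcases Nat.eq_zero_or_pos m with rfl | hm
        · exact hi ⟨k, by rw [e, P.pipow_zero, P.id_comp]⟩
        · refine L.comp_ne F' ?_
          rw [e, ← P.assoc]
          exact L.comp_pipow_comp_eq_zero F _ _ hm
    · rcases L.generates_right F k with ⟨m, rfl⟩ | ⟨m, rfl⟩
      · rcases Nat.eq_zero_or_pos m with rfl | hm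
        · exact hG ⟨h, by rw [e, P.pipow_zero, P.comp_id]⟩
        · refine L.comp_ne F' ?_
          rw [e, P.assoc, P.assoc]
          exact L.comp_pipow_comp_eq_zero F _ _ hm
      · rcases Nat.eq_zero_or_pos m with rfl | hm
        · exact hG ⟨h, by rw [e, P.pipow_zero, P.id_comp]⟩
        · rw [P.assoc] at e
          exact (L.generates_right F').ne_pipow_comp (L.right_ne F') _ hm e

/-- No nonzero morphism starts at `x 0` and ends outside the penny-farthing. -/
theorem hom_eq_zero (hy : ∀ i, x i ≠ y) (t : P.Hom (x 0) y) : t = P.zero (x 0) y := by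
  by_contra ht
  have L := H.loop
  have h3 := H.three_le
  obtain ⟨f, hgen⟩ := exists_generates (P := P) (x 0) y
  have hf : f ≠ P.zero (x 0) y := by
    rintro rfl
    rcases hgen t with ⟨i, h⟩ | ⟨i, h⟩
    · exact ht (h.trans (P.zero_comp _))
    · exact ht (h.trans (P.comp_zero _))
  have hz : ∀ (t : P.Hom (x 0) y) (h : P.Hom y (x 0)) d, P.comp h t = P.pipow (x 0) d →
      4 ≤ d := by
    intro t h d hd
    have := L.two_le (hy 0) h t hd
    by_contra hd4
    obtain rfl | rfl : d = 2 ∨ d = 3 := by lia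
    exacts [H.comp_ne_square hy h t hd, H.comp_ne_cube hy h t hd]
  have hleft : ∀ (t : P.Hom (x 0) y) (h : P.Hom y (x 0)), P.comp h t ≠ P.zero _ _ → t = f := by
    intro t h ht
    obtain ⟨d, hd⟩ := P.endo_cyclic (x 0) (P.comp h t)
    rw [hd] at ht
    exact absurd (L.pipow_eq_zero' (hz t h d hd)) ht
  have hlabel : ∀ (g : P.Hom y (x 0)) d, d < 3 → P.comp g f ≠ P.pipow (x 0) d :=
    fun g d hd h => by
      have := hz f g d h
      lia
  have h2 : 1 + 1 < n := h3
  have Q := H.fourPoints hy le_rfl h2 hf hgen hleft hlabel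
  have R := H.repFin_four le_rfl h2 hf hgen
  have hγo : (∃ g : P.Hom y (x 0), P.comp g f = P.pipow (x 0) 3) ↔ False :=
    iff_false_intro fun ⟨g, e⟩ => H.comp_ne_cube hy g f e
  have hγz : (∃ g : P.Hom y (x 1), P.comp g f = P.comp (v 1) (P.pipow (x 0) 1)) ↔ False :=
    iff_false_intro fun ⟨g, e⟩ => H.comp_ne_cube hy (P.comp (u 1) g) f
      (by rw [P.assoc, e, H.comp_pi_eq (by lia)])
  have hγw : (∃ g : P.Hom y (x (1 + 1)),
      P.comp g f = P.comp (P.comp (a 1) (v 1)) (P.pipow (x 0) 1)) ↔ False :=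
    iff_false_intro fun ⟨g, e⟩ => H.comp_ne_cube hy (P.comp (u (1 + 1)) g) f
      (by rw [P.assoc, e, ← H.v_succ, H.comp_pi_eq (by lia)])
  by_cases hw : ∃ k : P.Hom (x (1 + 1)) y, P.comp k (P.comp (a 1) (v 1)) = f
  · exact Q.not_repFin
      (iff_true_intro (hw.elim fun k e => ⟨P.comp k (a 1), by rw [P.assoc, e]⟩))
      (iff_true_intro hw) hγo hγz hγw _ familyZW
      (fun c c' o z w y ho _ hR _ hB hU _ _ hFw _ _ _ =>
        familyZW_inj c c' o z w y ho hR hB hU (hFw trivial)) R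
  by_cases hz : ∃ k : P.Hom (x 1) y, P.comp k (v 1) = f
  · exact Q.not_repFin (iff_true_intro hz) (iff_false_intro hw) hγo hγz hγw _ familyZ
      (fun c c' o z w y ho _ hR hV hB hU _ hFz _ _ _ _ =>
        familyZ_inj c c' o z w y ho hR hV hB hU (hFz trivial)) R
  · exact Q.not_repFin (iff_false_intro hz) (iff_false_intro hw) hγo hγz hγw _ familyNone
      (fun c c' o z w y ho _ hR hV hB hU hFo _ _ _ _ _ =>
        familyNone_inj c c' o z w y ho hR hV hB hU hFo) R

end Penny

end RayCategory

namespace RayCategory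

variable {P : RayCategory}

/-- The morphism given by an equality of objects. -/
def eqHom {b c : P.Obj} (h : b = c) : P.Hom b c := P.castHom rfl h (P.id b)

theorem eqHom_comp_eqHom_symm {b c : P.Obj} (h : b = c) :
    P.comp (eqHom h) (eqHom h.symm) = P.id c := by
  subst h
  exact P.comp_id _

theorem eqHom_comp {b c d : P.Obj} (h : b = c) (f : P.Hom d b) :
    P.comp (eqHom h) f = P.castHom rfl h f := by
  subst h
  exact P.id_comp f

theorem castHom_eq_of_heq {b c c' d : P.Obj} (h : c = d) (h' : c' = d) {f : P.Hom b c}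
    {f' : P.Hom b c'} (hf : HEq f f') : P.castHom rfl h f = P.castHom rfl h' f' := by
  subst h h'
  exact hf.eq ▸ rfl

theorem eqHom_comp_ne_comp_self {b c : P.Obj} (h : b = c) {f : P.Hom c b} {r : P.Hom c c}
    (hf : P.IsIrreducible f) (hr : P.IsIrreducible r) : P.comp (eqHom h) f ≠ P.comp r r := by
  subst h
  intro h
  rw [show P.comp (eqHom rfl) f = f from P.id_comp f] at h
  exact hr.2.1 (or_self_iff.1 (hf.2.2 _ r r h))

theorem comp_eqHom_comp_eq_zero {b b' c c' d : P.Obj} (h : b' = b) (h' : c' = c)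
    {f : P.Hom b c} {f' : P.Hom b' c'} (hf : HEq f' f) {g : P.Hom d b'}
    (hg : P.comp f' g = P.zero d c') : P.comp f (P.comp (eqHom h) g) = P.zero d c := by
  subst h h'
  obtain rfl := hf.eq
  rw [show P.comp (eqHom rfl) g = g from P.id_comp g, hg]

theorem eq_pipow_one {o : P.Obj} {r : P.Hom o o} (hr : P.IsIrreducible r) :
    r = P.pipow o 1 := by
  obtain ⟨i, rfl⟩ := P.endo_cyclic o r
  obtain rfl | rfl | ⟨j, rfl⟩ : i = 0 ∨ i = 1 ∨ ∃ j, i = j + 2 :=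
    match i with
    | 0 => .inl rfl
    | 1 => .inr (.inl rfl)
    | j + 2 => .inr (.inr ⟨j, rfl⟩)
  · exact absurd (isId_iff.2 (P.pipow_zero o)) hr.2.1
  · rfl
  · have h0 : ∀ t ≤ j + 2, P.pipow o t ≠ P.zero o o := fun t ht h =>
      hr.1 (pipow_mono_zero ht h)
    rcases hr.2.2 o (P.pipow o 1) (P.pipow o (j + 1)) (P.pipow_succ o (j + 1)) with h | h
    · rw [isId_iff, ← P.pipow_zero] at h
      exact absurd (pipow_injective h (h0 1 (by lia))) (by lia)
    · rw [isId_iff, ← P.pipow_zero] at h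
      exact absurd (pipow_injective h (h0 (j + 1) (by lia))) (by lia)

section Sequence

variable {x : ℕ → P.Obj} (a : ∀ i, P.Hom (x i) (x (i + 1)))

/-- The composition of the first `i` morphisms. -/
def forward : ∀ i, P.Hom (x 0) (x i)
  | 0 => P.id (x 0)
  | i + 1 => P.comp (a i) (forward i)

/-- The composition of the morphisms from `x i` to `x n` followed by `e`. -/
def backward {t : P.Obj} {n : ℕ} (e : P.Hom (x n) t) (i : ℕ) : P.Hom (x i) t :=
  if _h : i < n then P.comp (backward e (i + 1)) (a i)
  else if h : n = i then h ▸ e else P.zero (x i) t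
  termination_by n - i

variable {a} {t : P.Obj} {n : ℕ} (e : P.Hom (x n) t)

theorem backward_of_lt {i : ℕ} (hi : i < n) :
    backward a e i = P.comp (backward a e (i + 1)) (a i) := by
  rw [backward, dif_pos hi]

theorem backward_self : backward a e n = e := by
  rw [backward, dif_neg (lt_irrefl n), dif_pos rfl]

theorem heq_forward_chain (i : ℕ) : HEq (P.chain x a 0 i) (forward a i) := by
  induction i with
  | zero => rfl
  | succ i ih =>
    have key : ∀ j (_ : j = i) (f : P.Hom (x 0) (x j)), HEq f (forward a i) →
        HEq (P.comp (a j) f) (P.comp (a i) (forward a i)) := by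
      rintro j rfl f hf
      rw [hf.eq]
    exact key (0 + i) (Nat.zero_add i) _ ih

theorem exists_forward_eq {i : ℕ} (hi : 1 ≤ i) :
    ∃ f : P.Hom (x 1) (x i), forward a i = P.comp f (a 0) := by
  induction i, hi using Nat.le_induction with
  | base => exact ⟨P.id _, by rw [P.id_comp]; exact P.comp_id _⟩
  | succ i _ ih =>
    obtain ⟨f, hf⟩ := ih
    exact ⟨P.comp (a i) f, by rw [P.assoc, ← hf]; rfl⟩

theorem exists_backward_eq {i j : ℕ} (hij : i ≤ j) (hj : j ≤ n) :
    ∃ f : P.Hom (x i) (x j), backward a e i = P.comp (backward a e j) f ∧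
      forward a j = P.comp f (forward a i) := by
  induction j, hij using Nat.le_induction with
  | base => exact ⟨P.id _, (P.comp_id _).symm, (P.id_comp _).symm⟩
  | succ j _ ih =>
    obtain ⟨f, hf, hf'⟩ := ih (by lia)
    refine ⟨P.comp (a j) f, ?_, ?_⟩
    · rw [← P.assoc, ← backward_of_lt e (by lia), hf]
    · rw [P.assoc, ← hf']
      rfl

theorem backward_comp_forward {i : ℕ} (hi : i ≤ n) :
    P.comp (backward a e i) (forward a i) = P.comp e (forward a n) := by
  obtain ⟨f, hf, hf'⟩ := exists_backward_eq e hi le_rfl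
  rw [hf, hf', P.assoc, backward_self]

end Sequence

theorem mildLoop_of_contour {o : P.Obj} {r : P.Hom o o} (hr : P.IsIrreducible r)
    (C : Contour P o o) (hM : C.Mild)
    (hw : C.w = RPath.cons r hr (RPath.cons r hr (RPath.nil o)))
    (h4 : P.pipow o 4 = P.zero o o) : MildLoop P o := by
  obtain rfl := eq_pipow_one hr
  have hC : C.v.toHom = P.pipow o 2 := by
    rw [C.hom_eq, hw]
    simp only [RPath.toHom, P.comp_id, ← pipow_add]
  have hl : P.comp (P.pi o) C.v.toHom = P.pipow o 3 := by
    rw [hC, pi, ← pipow_add]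
  have hr' : P.comp C.v.toHom (P.pi o) = P.pipow o 3 := by
    rw [hC, pi, ← pipow_add]
  have hmem : ∀ {z : P.Obj}, (∃ g : P.Hom o z, ∀ h, g ≠ P.comp h (P.pipow o 3)) →
      z ∈ ProjSupp P (IdealOf P (P.pipow o 3)) o := by
    rintro z ⟨g, hg⟩
    refine ⟨g, fun h => hg (P.zero _ _) (by rw [h, P.zero_comp]), fun h => ?_⟩
    obtain ⟨k, rfl⟩ := exists_eq_comp_cube h
    exact hg k rfl
  refine ⟨hr, fun h3 => ?_, h4, fun D ho hD hfin hcard => ?_⟩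
  · have hd : ¬ P.IsDeep C.v.toHom := by
      rcases hM with hM | hM
      exacts [hM.1, hM.1]
    exact hd ⟨C.nz, hl.trans h3, hr'.trans h3⟩
  · rcases hM with ⟨-, -, hM⟩ | ⟨-, -, hM⟩
    · have := hM D
      rw [Contour.DecisiveT, Contour.It, hl] at this
      exact this ⟨ho, ho, fun z hz => .inl (hmem (hD z hz))⟩ hfin hcard
    · have := hM D
      rw [Contour.DecisiveC, Contour.Ic, hr'] at this
      exact this ⟨ho, ho, fun z hz => .inl (hmem (hD z hz))⟩ hfin hcard

end RayCategory

theorem PennyData.exists_penny {P : RayCategory} {n : ℕ} {x : ℕ → P.Obj}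
    {a : ∀ i : ℕ, P.Hom (x i) (x (i + 1))} {rho : P.Hom (x 0) (x 0)}
    (hPF : PennyData P n x a rho) (ha : ∀ i, P.IsIrreducible (a i))
    (hr : P.IsIrreducible rho) (C : Contour P (x 0) (x 0)) (hM : C.Mild)
    (hw : C.w = RPath.cons rho hr (RPath.cons rho hr (RPath.nil (x 0)))) (hn : n ≠ 2) :
    ∃ v u, P.Penny n x a v u := by
  obtain ⟨h1, hx, hax, hinj, -, -, -, hzero, hsq, -⟩ := hPF
  have hxn : x n = x 0 := by simpa using hx 0
  set e := RayCategory.eqHom hxn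
  have he : P.comp e (RayCategory.forward a n) = P.comp rho rho := by
    rw [RayCategory.eqHom_comp, ← hsq (hx 0)]
    exact RayCategory.castHom_eq_of_heq _ _ (RayCategory.heq_forward_chain n).symm
  have hrr : P.comp rho rho = P.pipow (x 0) 2 := by
    rw [RayCategory.eq_pipow_one hr, ← RayCategory.pipow_add]
  have hn1 : n ≠ 1 := by
    rintro rfl
    exact RayCategory.eqHom_comp_ne_comp_self hxn (ha 0) hr
      ((congrArg _ (P.comp_id _)).symm.trans he)
  have huv : ∀ i ≤ n, P.comp (RayCategory.backward a e i) (RayCategory.forward a i) =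
      P.pipow (x 0) 2 := fun i hi => by
    rw [RayCategory.backward_comp_forward e hi, he, hrr]
  have hvu : ∀ i, 1 ≤ i → i < n → P.comp (RayCategory.forward a i)
      (RayCategory.backward a e i) = P.zero (x i) (x i) := by
    intro i hi hin
    obtain ⟨m, rfl⟩ := Nat.exists_eq_add_of_le' h1
    obtain ⟨f, hf⟩ := RayCategory.exists_forward_eq (a := a) hi
    obtain ⟨g, hg, -⟩ := RayCategory.exists_backward_eq (a := a) e
      (show i ≤ m by lia) (by lia)
    have key : P.comp (a 0) (P.comp e (a m)) = P.zero _ _ := by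
      refine RayCategory.comp_eqHom_comp_eq_zero hxn ?_ (f' := a (m + 1)) ?_ ?_
      · have := hx 1
        rwa [show 1 + (m + 1) = m + 1 + 1 by lia] at this
      · have := hax 0
        rwa [Nat.zero_add] at this
      · exact (congrArg (P.comp (a (m + 1))) (P.comp_id (a m))).symm.trans hzero
    rw [hf, hg, RayCategory.backward_of_lt e (Nat.lt_succ_self m), RayCategory.backward_self,
      P.assoc, ← P.assoc (a 0), key, P.zero_comp, P.comp_zero]
  refine ⟨RayCategory.forward a, RayCategory.backward a e, by lia, ?_, ha, ?_, rfl,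
    fun _ => rfl, huv, hvu,
    RayCategory.eqHom hxn.symm, ?_, ?_⟩
  · refine RayCategory.mildLoop_of_contour hr C hM hw ?_
    rw [show 4 = 2 + 2 from rfl, RayCategory.pipow_add, ← huv 1 h1, P.assoc,
      ← P.assoc (RayCategory.forward a 1), hvu 1 le_rfl (by lia), P.zero_comp, P.comp_zero]
  · intro i j hij hj h
    exact hij.ne (hinj i j (by lia) hj h)
  · rw [← hrr, ← he, ← P.assoc, RayCategory.eqHom_comp_eqHom_symm hxn.symm, P.id_comp]
  · rw [RayCategory.backward_self, RayCategory.eqHom_comp_eqHom_symm]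

/-- **Lemma 3.2.** Let `C` be a mild contour which is a penny-farthing with points
`x 0, …, x (n-1)`, arrows `a i` and loop `ρ` at `x 0`.  If `P(x 0, y) ≠ {0}` for some
object `y` not belonging to `C`, then `n = 2`. -/
theorem pennyfarthing_n_eq_two (P : RayCategory) (n : ℕ) (x : ℕ → P.Obj)
    (a : ∀ i : ℕ, P.Hom (x i) (x (i + 1))) (rho : P.Hom (x 0) (x 0))
    (hPF : PennyData P n x a rho)
    (ha : ∀ i, P.IsIrreducible (a i)) (hr : P.IsIrreducible rho)
    (C : Contour P (x 0) (x 0)) (hM : C.Mild)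
    (hv : HEq C.v (pchain P x a ha 0 n))
    (hw : C.w = RPath.cons rho hr (RPath.cons rho hr (RPath.nil (x 0))))
    (yy : P.Obj) (hyy : yy ∉ Set.range x)
    (hnz : ∃ f : P.Hom (x 0) yy, f ≠ P.zero (x 0) yy) :
    n = 2 := by
  by_contra hn
  obtain ⟨v, u, H⟩ := hPF.exists_penny ha hr C hM hw hn
  obtain ⟨f, hf⟩ := hnz
  exact hf (H.hom_eq_zero (fun i h => hyy ⟨i, h⟩) f)
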